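/- arXiv:2312.09605 — 3 statements merged into one kernel-verified Lean document; each statement's English description precedes it below -/
import Mathlib

section
/- Let β > 0 and n ∈ ℕ, n ≥ 1. Let χ : ℝ → ℝ be a smooth compactly supported function that is equal to 1 in a neighbourhood of 0. There exists a constant C > 0 such that for every p ∈ [1,∞], every Schwartz function f on ℝⁿ and every λ > 0, the Fourier multiplier estimate ‖((1 − χ(λ|ξ|))/(λ|ξ|)^β)(D) f‖_{L^p(ℝⁿ)} ≤ C ‖((1 − χ(λ|ξ|))·(1 + λ²|ξ|²)^{-β/2})(D) f‖_{L^p(ℝⁿ)} holds. -/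
open MeasureTheory Real Complex
open scoped ENNReal InnerProductSpace

/-- Fourier transform with the convention `f̂(ξ) = (2π)^{-n/2} ∫ e^{-i x·ξ} f(x) dx`. -/
noncomputable def ft {n : ℕ} (f : EuclideanSpace ℝ (Fin n) → ℂ) (ξ : EuclideanSpace ℝ (Fin n)) : ℂ :=
  (((2 * π) ^ (-(n : ℝ) / 2) : ℝ) : ℂ) *
    ∫ x : EuclideanSpace ℝ (Fin n), Complex.exp (-Complex.I * (⟪x, ξ⟫_ℝ : ℂ)) * f x

/-- Fourier multiplier `m(D) f (x) = (2π)^{-n/2} ∫ e^{i x·ξ} m(ξ) f̂(ξ) dξ`. -/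
noncomputable def fmult {n : ℕ} (m : EuclideanSpace ℝ (Fin n) → ℂ)
    (f : EuclideanSpace ℝ (Fin n) → ℂ) (x : EuclideanSpace ℝ (Fin n)) : ℂ :=
  (((2 * π) ^ (-(n : ℝ) / 2) : ℝ) : ℂ) *
    ∫ ξ : EuclideanSpace ℝ (Fin n), Complex.exp (Complex.I * (⟪x, ξ⟫_ℝ : ℂ)) * m ξ * ft f ξ

/-- Unnormalised inverse Fourier integral. -/
noncomputable def finv {n : ℕ} (g : EuclideanSpace ℝ (Fin n) → ℂ)
    (x : EuclideanSpace ℝ (Fin n)) : ℂ :=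
  ∫ ξ : EuclideanSpace ℝ (Fin n), Complex.exp (Complex.I * (⟪x, ξ⟫_ℝ : ℂ)) * g ξ

theorem norm_cexp_I_mul (t : ℝ) : ‖Complex.exp (Complex.I * (t : ℂ))‖ = 1 := by
  rw [mul_comm]; exact Complex.norm_exp_ofReal_mul_I t

theorem finv_integrable {n : ℕ} {g : EuclideanSpace ℝ (Fin n) → ℂ} (hg : Integrable g)
    (x : EuclideanSpace ℝ (Fin n)) :
    Integrable (fun ξ : EuclideanSpace ℝ (Fin n) =>
      Complex.exp (Complex.I * (⟪x, ξ⟫_ℝ : ℂ)) * g ξ) := by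
  refine hg.bdd_mul (c := 1) ?_ ?_
  · exact (by fun_prop : Continuous fun ξ : EuclideanSpace ℝ (Fin n) =>
      Complex.exp (Complex.I * (⟪x, ξ⟫_ℝ : ℂ))).aestronglyMeasurable
  · exact Filter.Eventually.of_forall fun ξ => (norm_cexp_I_mul _).le

theorem finv_continuous {n : ℕ} {g : EuclideanSpace ℝ (Fin n) → ℂ} (hg : Integrable g) :
    Continuous (finv g) := by
  unfold finv
  refine continuous_of_dominated (bound := fun ξ => ‖g ξ‖) ?_ ?_ hg.norm ?_
  · exact fun x => (finv_integrable hg x).aestronglyMeasurable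
  · intro x
    refine Filter.Eventually.of_forall fun ξ => ?_
    rw [norm_mul, norm_cexp_I_mul, one_mul]
  · refine Filter.Eventually.of_forall fun ξ => ?_
    fun_prop

theorem enorm_le_of_continuous {n : ℕ} {u : EuclideanSpace ℝ (Fin n) → ℂ} (hu : Continuous u)
    (z : EuclideanSpace ℝ (Fin n)) : ‖u z‖ₑ ≤ eLpNorm u ⊤ volume := by
  have h := enorm_ae_le_eLpNormEssSup u (volume : Measure (EuclideanSpace ℝ (Fin n)))
  have hd := Measure.dense_of_ae h
  have hc : IsClosed {y | ‖u y‖ₑ ≤ eLpNormEssSup u volume} :=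
    isClosed_le (by fun_prop) continuous_const
  have := hc.closure_eq ▸ hd.closure_eq
  rw [eLpNorm_exponent_top]
  exact (Set.eq_univ_iff_forall.1 this) z

theorem minkowski_conv {n : ℕ} {u K : EuclideanSpace ℝ (Fin n) → ℂ} (hu : Continuous u)
    (hK : Integrable K) (a : ℝ) (p : ℝ≥0∞) (hp : 1 ≤ p) :
    eLpNorm (fun x => ∫ y, K y * u (x - a • y)) p volume ≤
      ENNReal.ofReal (∫ y, ‖K y‖) * eLpNorm u p volume := by
  have hA : ENNReal.ofReal (∫ y, ‖K y‖) = ∫⁻ y, ‖K y‖ₑ :=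
    ofReal_integral_norm_eq_lintegral_enorm hK
  rw [hA]
  set A := ∫⁻ y, ‖K y‖ₑ with hAdef
  have hpt : ∀ x, ‖∫ y, K y * u (x - a • y)‖ₑ ≤ ∫⁻ y, ‖K y‖ₑ * ‖u (x - a • y)‖ₑ := by
    intro x
    refine (enorm_integral_le_lintegral_enorm _).trans (le_of_eq ?_)
    simp only [enorm_mul]
  rcases eq_or_ne p ⊤ with rfl | hpt'
  · rw [eLpNorm_exponent_top]
    refine essSup_le_of_ae_le _ (Filter.Eventually.of_forall fun x => ?_)
    refine (hpt x).trans ?_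
    calc ∫⁻ y, ‖K y‖ₑ * ‖u (x - a • y)‖ₑ ≤ ∫⁻ y, ‖K y‖ₑ * eLpNorm u ⊤ volume := by
          refine lintegral_mono fun y => ?_
          gcongr
          exact enorm_le_of_continuous hu _
      _ = _ := lintegral_mul_const'' _ hK.1.enorm
  have hp0 : p ≠ 0 := (zero_lt_one.trans_le hp).ne'
  have hq : 1 ≤ p.toReal := by
    rw [← ENNReal.toReal_one]; exact ENNReal.toReal_mono hpt' hp
  set q := p.toReal with hqdef
  have hq0 : 0 < q := zero_lt_one.trans_le hq
  set ν := (volume : Measure (EuclideanSpace ℝ (Fin n))).withDensity (fun y => ‖K y‖ₑ) with hν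
  have hνu : ν Set.univ = A := by simp [hν, hAdef]
  have hAfin : A ≠ ⊤ := hK.2.ne
  have hpt2 : ∀ x, ‖∫ y, K y * u (x - a • y)‖ₑ ≤ ∫⁻ y, ‖u (x - a • y)‖ₑ ∂ν := by
    intro x
    refine (hpt x).trans (le_of_eq ?_)
    rw [hν, lintegral_withDensity_eq_lintegral_mul₀ hK.1.enorm]
    · rfl
    · exact (by fun_prop : Continuous fun y => ‖u (x - a • y)‖ₑ).aemeasurable
  have hpt3 : ∀ x, ‖∫ y, K y * u (x - a • y)‖ₑ ^ q ≤
      A ^ (q - 1) * ∫⁻ y, ‖u (x - a • y)‖ₑ ^ q ∂ν := by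
    intro x
    have h1 := eLpNorm'_le_eLpNorm'_mul_rpow_measure_univ (μ := ν) (f := fun y => u (x - a • y))
      zero_lt_one hq (by fun_prop : Continuous fun y => u (x - a • y)).aestronglyMeasurable
    simp only [eLpNorm', ENNReal.rpow_one, one_div, inv_one, hνu] at h1
    have h2 := ENNReal.rpow_le_rpow ((hpt2 x).trans h1) hq0.le
    refine h2.trans (le_of_eq ?_)
    rw [ENNReal.mul_rpow_of_nonneg _ _ hq0.le, ← ENNReal.rpow_mul, ← ENNReal.rpow_mul,
      inv_mul_cancel₀ hq0.ne', ENNReal.rpow_one, mul_comm]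
    congr 2
    field_simp
  rw [eLpNorm_eq_lintegral_rpow_enorm_toReal hp0 hpt',
    eLpNorm_eq_lintegral_rpow_enorm_toReal hp0 hpt']
  have key : ∫⁻ x, ‖∫ y, K y * u (x - a • y)‖ₑ ^ q ≤ A ^ q * ∫⁻ x, ‖u x‖ₑ ^ q := by
    calc ∫⁻ x, ‖∫ y, K y * u (x - a • y)‖ₑ ^ q
        ≤ ∫⁻ x, A ^ (q - 1) * ∫⁻ y, ‖u (x - a • y)‖ₑ ^ q ∂ν := lintegral_mono hpt3
      _ = A ^ (q - 1) * ∫⁻ x, ∫⁻ y, ‖u (x - a • y)‖ₑ ^ q ∂ν := by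
          refine lintegral_const_mul' _ _ (ENNReal.rpow_ne_top_of_nonneg (by linarith) hAfin)
      _ = A ^ (q - 1) * ∫⁻ y, (∫⁻ x, ‖u (x - a • y)‖ₑ ^ q) ∂ν := by
          rw [lintegral_lintegral_swap]
          refine Measurable.aemeasurable ?_
          exact (by fun_prop : Continuous fun z : EuclideanSpace ℝ (Fin n) ×
            EuclideanSpace ℝ (Fin n) => u (z.1 - a • z.2)).measurable.enorm.pow_const q
      _ = A ^ (q - 1) * ∫⁻ y, (∫⁻ x, ‖u x‖ₑ ^ q) ∂ν := by
          congr 2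
          ext y
          exact lintegral_sub_right_eq_self (fun x => ‖u x‖ₑ ^ q) (a • y)
      _ = A ^ q * ∫⁻ x, ‖u x‖ₑ ^ q := by
          rw [lintegral_const, hνu, mul_comm (∫⁻ x, ‖u x‖ₑ ^ q), ← mul_assoc]
          congr 1
          nth_rewrite 2 [← ENNReal.rpow_one A]
          rw [← ENNReal.rpow_add_of_nonneg _ _ (by linarith) zero_le_one]
          congr 1; ring
  calc _ ≤ (A ^ q * ∫⁻ x, ‖u x‖ₑ ^ q) ^ (1 / q) :=
        ENNReal.rpow_le_rpow key (by positivity)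
    _ = _ := by
        rw [ENNReal.mul_rpow_of_nonneg _ _ (by positivity), ← ENNReal.rpow_mul,
          mul_one_div_cancel hq0.ne', ENNReal.rpow_one]

/-- `m` is a dilation-uniform multiplier on all `L^p` spaces, with constant `c`. -/
def Bdd {n : ℕ} (m : EuclideanSpace ℝ (Fin n) → ℂ) (c : ℝ) : Prop :=
  Continuous m ∧ (∀ ξ, ‖m ξ‖ ≤ c) ∧
    ∀ g : EuclideanSpace ℝ (Fin n) → ℂ, Integrable g → ∀ lam : ℝ, 0 < lam →
      ∀ p : ℝ≥0∞, 1 ≤ p →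
        eLpNorm (finv fun ξ => m (lam • ξ) * g ξ) p volume ≤
          ENNReal.ofReal c * eLpNorm (finv g) p volume

theorem Bdd.nonneg {n : ℕ} {m : EuclideanSpace ℝ (Fin n) → ℂ} {c : ℝ} (h : Bdd m c) : 0 ≤ c :=
  (norm_nonneg _).trans (h.2.1 0)

theorem Bdd.integrable {n : ℕ} {m : EuclideanSpace ℝ (Fin n) → ℂ} {c : ℝ} (h : Bdd m c)
    {g : EuclideanSpace ℝ (Fin n) → ℂ} (hg : Integrable g) (lam : ℝ) :
    Integrable fun ξ => m (lam • ξ) * g ξ := by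
  refine hg.bdd_mul (c := c) ?_ (Filter.Eventually.of_forall fun ξ => h.2.1 _)
  have := h.1
  exact (by fun_prop : Continuous fun ξ => m (lam • ξ)).aestronglyMeasurable

theorem Bdd.one {n : ℕ} : Bdd (fun _ : EuclideanSpace ℝ (Fin n) => (1 : ℂ)) 1 := by
  refine ⟨continuous_const, by simp, ?_⟩
  intro g _ lam _ p _
  simp

theorem Bdd.mul {n : ℕ} {m₁ m₂ : EuclideanSpace ℝ (Fin n) → ℂ} {c₁ c₂ : ℝ} (h₁ : Bdd m₁ c₁)
    (h₂ : Bdd m₂ c₂) : Bdd (fun ξ => m₁ ξ * m₂ ξ) (c₁ * c₂) := by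
  refine ⟨h₁.1.mul h₂.1, fun ξ => ?_, ?_⟩
  · rw [norm_mul]
    exact mul_le_mul (h₁.2.1 ξ) (h₂.2.1 ξ) (norm_nonneg _) h₁.nonneg
  · intro g hg lam hl p hp
    have a := h₁.2.2 _ (h₂.integrable hg lam) lam hl p hp
    have b := h₂.2.2 g hg lam hl p hp
    simp only [mul_assoc]
    rw [ENNReal.ofReal_mul h₁.nonneg, mul_assoc]
    exact a.trans (by gcongr)

theorem Bdd.pow {n : ℕ} {m : EuclideanSpace ℝ (Fin n) → ℂ} {c : ℝ} (h : Bdd m c) (k : ℕ) :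
    Bdd (fun ξ => m ξ ^ k) (c ^ k) := by
  induction k with
  | zero => simpa using Bdd.one
  | succ k ih => simpa only [pow_succ] using ih.mul h

theorem finv_add {n : ℕ} {g h : EuclideanSpace ℝ (Fin n) → ℂ} (hg : Integrable g)
    (hh : Integrable h) : finv (fun ξ => g ξ + h ξ) = fun x => finv g x + finv h x := by
  ext x
  simp only [finv, mul_add]
  exact integral_add (finv_integrable hg x) (finv_integrable hh x)

theorem finv_const_mul {n : ℕ} (z : ℂ) (g : EuclideanSpace ℝ (Fin n) → ℂ) :
    finv (fun ξ => z * g ξ) = fun x => z * finv g x := by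
  ext x
  simp only [finv]
  rw [← integral_const_mul]
  congr 1; ext ξ; ring

theorem Bdd.add {n : ℕ} {m₁ m₂ : EuclideanSpace ℝ (Fin n) → ℂ} {c₁ c₂ : ℝ} (h₁ : Bdd m₁ c₁)
    (h₂ : Bdd m₂ c₂) : Bdd (fun ξ => m₁ ξ + m₂ ξ) (c₁ + c₂) := by
  refine ⟨h₁.1.add h₂.1, fun ξ => (norm_add_le _ _).trans (add_le_add (h₁.2.1 ξ) (h₂.2.1 ξ)), ?_⟩
  intro g hg lam hl p hp
  have a := h₁.2.2 g hg lam hl p hp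
  have b := h₂.2.2 g hg lam hl p hp
  have i₁ := h₁.integrable hg lam
  have i₂ := h₂.integrable hg lam
  simp only [add_mul]
  rw [finv_add i₁ i₂, ENNReal.ofReal_add h₁.nonneg h₂.nonneg, add_mul]
  exact (eLpNorm_add_le (finv_continuous i₁).aestronglyMeasurable
    (finv_continuous i₂).aestronglyMeasurable hp).trans (add_le_add a b)

theorem Bdd.const_mul {n : ℕ} {m : EuclideanSpace ℝ (Fin n) → ℂ} {c : ℝ} (h : Bdd m c) (z : ℂ) :
    Bdd (fun ξ => z * m ξ) (‖z‖ * c) := by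
  refine ⟨continuous_const.mul h.1, fun ξ => ?_, ?_⟩
  · rw [norm_mul]; exact mul_le_mul_of_nonneg_left (h.2.1 ξ) (norm_nonneg _)
  · intro g hg lam hl p hp
    have a := h.2.2 g hg lam hl p hp
    simp only [mul_assoc]
    rw [finv_const_mul]
    have : eLpNorm (fun x => z * finv (fun ξ => m (lam • ξ) * g ξ) x) p volume =
        ‖z‖ₑ * eLpNorm (finv fun ξ => m (lam • ξ) * g ξ) p volume :=
      eLpNorm_const_smul z (finv fun ξ => m (lam • ξ) * g ξ) p volume
    rw [this, ENNReal.ofReal_mul (norm_nonneg _), ofReal_norm, mul_assoc]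
    gcongr

theorem Bdd.dil {n : ℕ} {m : EuclideanSpace ℝ (Fin n) → ℂ} {c : ℝ} (h : Bdd m c) {a : ℝ}
    (ha : 0 < a) : Bdd (fun ξ => m (a • ξ)) c := by
  have := h.1
  refine ⟨by fun_prop, fun ξ => h.2.1 _, ?_⟩
  intro g hg lam hl p hp
  simpa only [smul_smul] using h.2.2 g hg (a * lam) (by positivity) p hp

theorem Bdd.zero {n : ℕ} : Bdd (fun _ : EuclideanSpace ℝ (Fin n) => (0 : ℂ)) 0 := by
  simpa using (Bdd.one (n := n)).const_mul 0

theorem Bdd.sum {n : ℕ} {m : ℕ → EuclideanSpace ℝ (Fin n) → ℂ} {c : ℕ → ℝ}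
    (h : ∀ k, Bdd (m k) (c k)) (N : ℕ) :
    Bdd (fun ξ => ∑ k ∈ Finset.range N, m k ξ) (∑ k ∈ Finset.range N, c k) := by
  induction N with
  | zero => simpa using Bdd.zero
  | succ N ih => simpa only [Finset.sum_range_succ] using ih.add (h N)

theorem Bdd.tsum {n : ℕ} {m : ℕ → EuclideanSpace ℝ (Fin n) → ℂ} {c : ℕ → ℝ}
    (h : ∀ k, Bdd (m k) (c k)) (hc : Summable c) :
    Bdd (fun ξ => ∑' k, m k ξ) (∑' k, c k) := by
  have hs : ∀ ξ, Summable fun k => m k ξ := fun ξ =>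
    Summable.of_norm_bounded hc (fun k => (h k).2.1 ξ)
  have hle : ∀ N, ∑ k ∈ Finset.range N, c k ≤ ∑' k, c k := fun N =>
    hc.sum_le_tsum _ (fun k _ => (h k).nonneg)
  refine ⟨continuous_tsum (fun k => (h k).1) hc fun k ξ => (h k).2.1 ξ, fun ξ =>
    tsum_of_norm_bounded hc.hasSum (fun k => (h k).2.1 ξ), ?_⟩
  intro g hg lam hl p hp
  have hlim : ∀ x, Filter.Tendsto
      (fun N => finv (fun ξ => (∑ k ∈ Finset.range N, m k (lam • ξ)) * g ξ) x) Filter.atTop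
      (nhds (finv (fun ξ => (∑' k, m k (lam • ξ)) * g ξ) x)) := by
    intro x
    unfold finv
    refine tendsto_integral_of_dominated_convergence (fun ξ => (∑' k, c k) * ‖g ξ‖) ?_ ?_ ?_ ?_
    · intro N
      exact (finv_integrable ((Bdd.sum h N).integrable hg lam) x).aestronglyMeasurable
    · exact hg.norm.const_mul _
    · intro N
      refine Filter.Eventually.of_forall fun ξ => ?_
      rw [norm_mul, norm_cexp_I_mul, one_mul, norm_mul]
      exact mul_le_mul_of_nonneg_right (((Bdd.sum h N).2.1 _).trans (hle N)) (norm_nonneg _)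
    · refine Filter.Eventually.of_forall fun ξ => ?_
      exact ((hs _).hasSum.tendsto_sum_nat.mul_const _).const_mul _
  refine (Lp.eLpNorm_lim_le_liminf_eLpNorm (f := fun N => finv (fun ξ =>
    (∑ k ∈ Finset.range N, m k (lam • ξ)) * g ξ)) (fun N =>
      (finv_continuous ((Bdd.sum h N).integrable hg lam)).aestronglyMeasurable) _
      (Filter.Eventually.of_forall hlim)).trans ?_
  refine (Filter.liminf_le_liminf (v := fun _ => ENNReal.ofReal (∑' k, c k) *
    eLpNorm (finv g) p volume) (Filter.Eventually.of_forall fun N => ?_)).trans_eq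
    (Filter.liminf_const _)
  refine ((Bdd.sum h N).2.2 g hg lam hl p hp).trans ?_
  gcongr
  exact hle N

theorem Bdd.of_kernel {n : ℕ} {K m : EuclideanSpace ℝ (Fin n) → ℂ} (hK : Integrable K)
    (hmc : Continuous m)
    (hm : ∀ ξ, m ξ = ∫ y, Complex.exp (Complex.I * ((-(2 * π) * ⟪y, ξ⟫_ℝ : ℝ) : ℂ)) * K y) :
    Bdd m (∫ y, ‖K y‖) := by
  refine ⟨hmc, fun ξ => ?_, ?_⟩
  · rw [hm]
    refine (norm_integral_le_integral_norm _).trans (le_of_eq ?_)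
    simp only [norm_mul, norm_cexp_I_mul, one_mul]
  · intro g hg lam hl p hp
    have : (finv fun ξ => m (lam • ξ) * g ξ) =
        fun x => ∫ y, K y * finv g (x - (2 * π * lam) • y) := by
      ext x
      have e1 : finv (fun ξ => m (lam • ξ) * g ξ) x = ∫ ξ, ∫ y,
          Complex.exp (Complex.I * ((⟪x, ξ⟫_ℝ + -(2 * π) * ⟪y, lam • ξ⟫_ℝ : ℝ) : ℂ)) *
            (g ξ * K y) := by
        unfold finv
        congr 1; ext ξ
        beta_reduce
        rw [hm, ← integral_mul_const, ← integral_const_mul]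
        congr 1; ext y
        push_cast
        rw [mul_add, Complex.exp_add]
        ring
      rw [e1, integral_integral_swap]
      · congr 1; ext y
        unfold finv
        rw [← integral_const_mul]
        congr 1; ext ξ
        rw [inner_sub_left, inner_smul_left, inner_smul_right]
        simp only [conj_trivial]
        push_cast
        rw [mul_left_comm (K y), mul_comm (K y)]
        congr 3
        ring
      · have hgK : Integrable (fun z : EuclideanSpace ℝ (Fin n) × EuclideanSpace ℝ (Fin n) =>
            g z.1 * K z.2) (volume.prod volume) := hg.mul_prod hK
        refine hgK.bdd_mul (c := 1) ?_ (Filter.Eventually.of_forall fun ξ => (norm_cexp_I_mul _).le)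
        exact (by fun_prop : Continuous fun z : EuclideanSpace ℝ (Fin n) ×
          EuclideanSpace ℝ (Fin n) => Complex.exp (Complex.I *
            ((⟪x, z.1⟫_ℝ + -(2 * π) * ⟪z.2, lam • z.1⟫_ℝ : ℝ) : ℂ))).aestronglyMeasurable
    rw [this]
    exact minkowski_conv (finv_continuous hg) hK _ p hp

open FourierTransform in
theorem Bdd.of_schwartz {n : ℕ} (φ : SchwartzMap (EuclideanSpace ℝ (Fin n)) ℂ) :
    ∃ c, Bdd (⇑φ) c := by
  refine ⟨_, Bdd.of_kernel (K := ⇑(𝓕⁻ φ : SchwartzMap (EuclideanSpace ℝ (Fin n)) ℂ))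
    (𝓕⁻ φ : SchwartzMap (EuclideanSpace ℝ (Fin n)) ℂ).integrable φ.continuous ?_⟩
  intro ξ
  have h : φ = 𝓕 (𝓕⁻ φ) := (fourier_fourierInv_eq φ).symm
  conv_lhs => rw [h]
  rw [SchwartzMap.fourier_coe, Real.fourier_eq']
  congr 1; ext y
  rw [smul_eq_mul, mul_comm Complex.I]
  push_cast
  ring_nf

theorem Bdd.of_compact {n : ℕ} {φ : EuclideanSpace ℝ (Fin n) → ℝ} (h : ContDiff ℝ (⊤ : ℕ∞) φ)
    (hc : HasCompactSupport φ) : ∃ c, Bdd (fun ξ => (φ ξ : ℂ)) c := by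
  have h1 : HasCompactSupport (fun ξ => (φ ξ : ℂ)) := hc.comp_left (g := fun t : ℝ => (t : ℂ)) rfl
  have h2 : ContDiff ℝ (⊤ : ℕ∞) (fun ξ => (φ ξ : ℂ)) := Complex.ofRealCLM.contDiff.comp h
  exact Bdd.of_schwartz (h1.toSchwartzMap h2)

theorem radial_bdd (n : ℕ) {k : ℝ → ℝ} {a b : ℝ} (ha : 0 < a) (h0 : ∀ x, x ≤ a → k x = 0)
    (hb0 : 0 ≤ b) (hb : ∀ x, b ≤ x → k x = 0) (hk : ∀ x, 0 < x → ContDiffAt ℝ (⊤ : ℕ∞) k x) :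
    ∃ c, Bdd (fun ξ : EuclideanSpace ℝ (Fin n) => ((k (‖ξ‖ ^ 2) : ℝ) : ℂ)) c := by
  refine Bdd.of_compact (φ := fun ξ => k (‖ξ‖ ^ 2)) ?_ ?_
  · rw [contDiff_iff_contDiffAt]
    intro ξ
    by_cases h : ‖ξ‖ ^ 2 < a
    · refine (contDiffAt_const (c := (0 : ℝ))).congr_of_eventuallyEq ?_
      have : ∀ᶠ η : EuclideanSpace ℝ (Fin n) in nhds ξ, ‖η‖ ^ 2 < a :=
        (by fun_prop : Continuous fun η : EuclideanSpace ℝ (Fin n) => ‖η‖ ^ 2).continuousAt.eventually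
          (gt_mem_nhds h)
      filter_upwards [this] with η hη
      exact h0 _ hη.le
    · have := (hk (‖ξ‖ ^ 2) (lt_of_lt_of_le ha (not_lt.1 h)))
      exact this.comp ξ (contDiff_norm_sq ℝ).contDiffAt
  · refine HasCompactSupport.intro (isCompact_closedBall 0 (b + 1)) fun ξ hξ => ?_
    simp only [Metric.mem_closedBall, dist_zero_right, not_le] at hξ
    exact hb _ (by nlinarith)

/-- smooth step: `0` on `(-∞,1]`, `1` on `[2,∞)`. -/
noncomputable def stp (x : ℝ) : ℝ := Real.smoothTransition (x - 1)

theorem stp_zero {x : ℝ} (h : x ≤ 1) : stp x = 0 :=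
  Real.smoothTransition.zero_of_nonpos (by linarith)

theorem stp_one {x : ℝ} (h : 2 ≤ x) : stp x = 1 :=
  Real.smoothTransition.one_of_one_le (by linarith)

theorem stp_nonneg (x : ℝ) : 0 ≤ stp x := Real.smoothTransition.nonneg _

theorem stp_contDiff : ContDiff ℝ (⊤ : ℕ∞) stp := by
  unfold stp
  exact Real.smoothTransition.contDiff.comp (by fun_prop)

theorem V_bdd (n : ℕ) :
    ∃ c, Bdd (fun ξ : EuclideanSpace ℝ (Fin n) => ((stp (‖ξ‖ ^ 2) / ‖ξ‖ ^ 2 : ℝ) : ℂ)) c := by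
  have hs := stp_contDiff
  obtain ⟨c, hc⟩ := radial_bdd n (k := fun y => (stp y - stp (y / 4)) / y) (a := 1) (b := 8)
    one_pos (by intro x hx; simp [stp_zero hx, stp_zero (show x / 4 ≤ 1 by linarith)])
    (by norm_num)
    (by intro x hx; simp [stp_one (show 2 ≤ x by linarith), stp_one (show 2 ≤ x / 4 by linarith)])
    (by
      intro x hx
      refine ContDiffAt.div (ContDiff.contDiffAt ?_) contDiffAt_id hx.ne'
      exact hs.sub (hs.comp (contDiff_id.div_const 4)))
  have hk : ∀ j : ℕ, Bdd (fun ξ : EuclideanSpace ℝ (Fin n) =>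
      (((1 / 4) ^ j : ℝ) : ℂ) * (((stp (‖((1 / 2 : ℝ) ^ j) • ξ‖ ^ 2) -
        stp (‖((1 / 2 : ℝ) ^ j) • ξ‖ ^ 2 / 4)) / ‖((1 / 2 : ℝ) ^ j) • ξ‖ ^ 2 : ℝ) : ℂ))
      (‖(((1 / 4) ^ j : ℝ) : ℂ)‖ * c) := fun j =>
    (hc.dil (a := (1 / 2 : ℝ) ^ j) (by positivity)).const_mul _
  have hsum : Summable fun j : ℕ => ‖(((1 / 4) ^ j : ℝ) : ℂ)‖ * c := by
    refine Summable.mul_right _ ?_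
    simp only [Complex.norm_real, norm_pow]
    exact summable_geometric_of_lt_one (norm_nonneg _) (by norm_num)
  refine ⟨∑' j : ℕ, ‖(((1 / 4) ^ j : ℝ) : ℂ)‖ * c, ?_⟩
  convert Bdd.tsum hk hsum using 1
  ext ξ
  symm
  have hsm : Summable fun j => (((1 / 4) ^ j : ℝ) : ℂ) * (((stp (‖((1 / 2 : ℝ) ^ j) • ξ‖ ^ 2) -
        stp (‖((1 / 2 : ℝ) ^ j) • ξ‖ ^ 2 / 4)) / ‖((1 / 2 : ℝ) ^ j) • ξ‖ ^ 2 : ℝ) : ℂ) :=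
    Summable.of_norm_bounded hsum (fun k => (hk k).2.1 ξ)
  refine HasSum.tsum_eq ((hsm.hasSum_iff_tendsto_nat).2 ?_)
  set x := ‖ξ‖ ^ 2 with hx
  have hterm : ∀ j : ℕ, (((1 / 4) ^ j : ℝ) : ℂ) * (((stp (‖((1 / 2 : ℝ) ^ j) • ξ‖ ^ 2) -
        stp (‖((1 / 2 : ℝ) ^ j) • ξ‖ ^ 2 / 4)) / ‖((1 / 2 : ℝ) ^ j) • ξ‖ ^ 2 : ℝ) : ℂ) =
        ((stp ((1 / 4) ^ j * x) / x - stp ((1 / 4) ^ (j + 1) * x) / x : ℝ) : ℂ) := by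
    intro j
    have e : ‖((1 / 2 : ℝ) ^ j) • ξ‖ ^ 2 = (1 / 4) ^ j * x := by
      rw [norm_smul, mul_pow, norm_pow, ← pow_mul, mul_comm j 2, pow_mul, hx]
      norm_num
    rw [e, ← Complex.ofReal_mul]
    congr 1
    rw [show (1 / 4 : ℝ) ^ (j + 1) * x = (1 / 4) ^ j * x / 4 by rw [pow_succ]; ring]
    rcases eq_or_ne x 0 with h0 | h0
    · simp [h0]
    · have : ((1 / 4 : ℝ) ^ j) ≠ 0 := by positivity
      field_simp
  simp only [hterm]
  simp only [← Complex.ofReal_sum, Finset.sum_range_sub' (fun j => stp ((1 / 4) ^ j * x) / x)]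
  have hev : ∀ᶠ N : ℕ in Filter.atTop, stp ((1 / 4) ^ N * x) = 0 := by
    have ht : Filter.Tendsto (fun N : ℕ => (1 / 4 : ℝ) ^ N * x) Filter.atTop (nhds (0 * x)) :=
      (tendsto_pow_atTop_nhds_zero_of_lt_one (by norm_num) (by norm_num)).mul_const x
    rw [zero_mul] at ht
    filter_upwards [ht.eventually (gt_mem_nhds zero_lt_one)] with N hN
    exact stp_zero hN.le
  refine tendsto_const_nhds.congr' ?_
  filter_upwards [hev] with N hN
  rw [hN]
  simp

theorem binom_bdd {n : ℕ} {v : EuclideanSpace ℝ (Fin n) → ℝ} {c : ℝ}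
    (h : Bdd (fun ξ => (v ξ : ℂ)) c) (hc : c < 1) (b : ℝ) :
    ∃ C, Bdd (fun ξ => (((1 + v ξ) ^ b : ℝ) : ℂ)) C := by
  have hps := Real.one_add_rpow_hasFPowerSeriesOnBall_zero (a := b)
  have hk : ∀ k : ℕ, Bdd (fun ξ => ((Ring.choose b k : ℝ) : ℂ) * (v ξ : ℂ) ^ k)
      (‖((Ring.choose b k : ℝ) : ℂ)‖ * c ^ k) := fun k => (h.pow k).const_mul _
  have hsum : Summable fun k : ℕ => ‖((Ring.choose b k : ℝ) : ℂ)‖ * c ^ k := by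
    lift c to NNReal using h.nonneg
    have hr : (c : ℝ≥0∞) < (binomialSeries ℝ b).radius := by
      refine lt_of_lt_of_le ?_ hps.r_le
      exact_mod_cast hc
    have := (binomialSeries ℝ b).summable_norm_mul_pow hr
    refine this.congr fun k => ?_
    simp [binomialSeries]
  refine ⟨∑' k : ℕ, ‖((Ring.choose b k : ℝ) : ℂ)‖ * c ^ k, ?_⟩
  convert Bdd.tsum hk hsum using 1
  ext ξ
  have hv : |v ξ| < 1 := by
    have := h.2.1 ξ
    rw [Complex.norm_real] at this
    exact this.trans_lt hc
  have := hps.hasSum (y := v ξ) (by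
    rw [mem_eball_zero_iff, ← ofReal_norm, Real.norm_eq_abs]
    exact ENNReal.ofReal_lt_one.2 hv)
  simp only [zero_add, binomialSeries_apply] at this
  rw [← this.tsum_eq, Complex.ofReal_tsum]
  simp

theorem W_bdd (n : ℕ) (b : ℝ) {ε : ℝ} (hε : 0 < ε) :
    ∃ (W : EuclideanSpace ℝ (Fin n) → ℝ) (C : ℝ), Bdd (fun ξ => (W ξ : ℂ)) C ∧
      ∀ ξ, ε ≤ ‖ξ‖ → W ξ = (1 + 1 / ‖ξ‖ ^ 2) ^ b := by
  have hs := stp_contDiff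
  obtain ⟨c, hc⟩ := V_bdd n
  have hc0 := hc.nonneg
  obtain ⟨δ, hδ, hδc⟩ : ∃ δ : ℝ, 0 < δ ∧ δ ^ 2 * c < 1 := by
    refine ⟨1 / (c + 1), by positivity, ?_⟩
    rw [div_pow, one_pow, div_mul_eq_mul_div, div_lt_one (by positivity)]
    nlinarith
  have hv : Bdd (fun ξ : EuclideanSpace ℝ (Fin n) =>
      ((stp (δ ^ 2 * ‖ξ‖ ^ 2) / ‖ξ‖ ^ 2 : ℝ) : ℂ)) (δ ^ 2 * c) := by
    have := (hc.dil hδ).const_mul ((δ ^ 2 : ℝ) : ℂ)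
    rw [Complex.norm_real, Real.norm_of_nonneg (by positivity)] at this
    convert this using 1
    ext ξ
    rw [← Complex.ofReal_mul, norm_smul, Real.norm_of_nonneg hδ.le, mul_pow]
    congr 1
    rcases eq_or_ne (‖ξ‖ ^ 2) 0 with h0 | h0
    · simp [h0]
    · field_simp
  obtain ⟨C₁, h₁⟩ := binom_bdd hv hδc b
  obtain ⟨C₂, h₂⟩ := radial_bdd n (k := fun x => stp (2 / ε ^ 2 * x) *
      ((1 + 1 / x) ^ b - (1 + stp (δ ^ 2 * x) / x) ^ b)) (a := ε ^ 2 / 2) (b := 2 / δ ^ 2)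
    (by positivity)
    (by
      intro x hx
      have : 2 / ε ^ 2 * x ≤ 1 := by
        rw [div_mul_eq_mul_div, div_le_one (by positivity)]; linarith
      simp [stp_zero this])
    (by positivity)
    (by
      intro x hx
      have : 2 ≤ δ ^ 2 * x := by
        rw [div_le_iff₀ (by positivity)] at hx; linarith
      simp [stp_one this])
    (by
      intro x hx
      have i : ContDiffAt ℝ (⊤ : ℕ∞) (fun x : ℝ => 1 + 1 / x) x :=
        contDiffAt_const.add (contDiffAt_const.div contDiffAt_id hx.ne')
      have j : ContDiffAt ℝ (⊤ : ℕ∞) (fun x : ℝ => 1 + stp (δ ^ 2 * x) / x) x :=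
        contDiffAt_const.add (ContDiffAt.div
          (hs.comp (contDiff_const.mul contDiff_id)).contDiffAt contDiffAt_id hx.ne')
      refine ContDiffAt.mul (hs.comp (contDiff_const.mul contDiff_id)).contDiffAt ?_
      refine ContDiffAt.sub (i.rpow_const_of_ne ?_) (j.rpow_const_of_ne ?_)
      · positivity
      · have := stp_nonneg (δ ^ 2 * x)
        positivity)
  refine ⟨fun ξ => (1 + stp (δ ^ 2 * ‖ξ‖ ^ 2) / ‖ξ‖ ^ 2) ^ b + stp (2 / ε ^ 2 * ‖ξ‖ ^ 2) *
      ((1 + 1 / ‖ξ‖ ^ 2) ^ b - (1 + stp (δ ^ 2 * ‖ξ‖ ^ 2) / ‖ξ‖ ^ 2) ^ b), C₁ + C₂, ?_, ?_⟩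
  · simpa only [Complex.ofReal_add] using h₁.add h₂
  · intro ξ hξ
    have : 2 ≤ 2 / ε ^ 2 * ‖ξ‖ ^ 2 := by
      rw [div_mul_eq_mul_div, le_div_iff₀ (by positivity)]
      have : ε ^ 2 ≤ ‖ξ‖ ^ 2 := by gcongr
      linarith
    simp [stp_one this]

open FourierTransform in
theorem ft_integrable {n : ℕ} (f : SchwartzMap (EuclideanSpace ℝ (Fin n)) ℂ) :
    Integrable (ft ⇑f) := by
  have h1 : Integrable (⇑(𝓕 f : SchwartzMap (EuclideanSpace ℝ (Fin n)) ℂ)) :=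
    SchwartzMap.integrable _
  have h2 := (h1.comp_smul (R := (2 * π)⁻¹) (by positivity)).const_mul
    (((2 * π) ^ (-(n : ℝ) / 2) : ℝ) : ℂ)
  convert h2 using 1
  ext ξ
  unfold ft
  rw [SchwartzMap.fourier_coe, Real.fourier_eq']
  congr 2
  ext x
  rw [smul_eq_mul, inner_smul_right]
  congr 2
  push_cast
  have : (π : ℂ) ≠ 0 := by exact_mod_cast Real.pi_ne_zero
  field_simp

theorem fmult_eq {n : ℕ} (m f : EuclideanSpace ℝ (Fin n) → ℂ) :
    fmult m f = (((2 * π) ^ (-(n : ℝ) / 2) : ℝ) : ℂ) • finv (fun ξ => m ξ * ft f ξ) := by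
  ext x
  simp only [fmult, finv, mul_assoc, Pi.smul_apply, smul_eq_mul]

/-- High-frequency comparison of the homogeneous and inhomogeneous multipliers
`(1−χ(λ|D|))/(λ|D|)^β` and `(1−χ(λ|D|))(1+λ²|D|²)^{-β/2}` on `L^p(ℝⁿ)` (Lemma B.3). -/
theorem stmt6 (β : ℝ) (hβ : 0 < β) (n : ℕ) (hn : 1 ≤ n) (χ : ℝ → ℝ)
    (hχ : ContDiff ℝ (⊤ : ℕ∞) χ) (hχc : HasCompactSupport χ)
    (hχ1 : ∀ᶠ y in nhds (0 : ℝ), χ y = 1) :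
    ∃ C : ℝ, 0 < C ∧ ∀ p : ℝ≥0∞, 1 ≤ p →
      ∀ f : SchwartzMap (EuclideanSpace ℝ (Fin n)) ℂ, ∀ lam : ℝ, 0 < lam →
        eLpNorm
          (fmult (fun ξ => (((1 - χ (lam * ‖ξ‖)) / (lam * ‖ξ‖) ^ β : ℝ) : ℂ)) ⇑f) p volume ≤
          ENNReal.ofReal C *
            eLpNorm
              (fmult (fun ξ =>
                (((1 - χ (lam * ‖ξ‖)) * (1 + lam ^ 2 * ‖ξ‖ ^ 2) ^ (-(β / 2)) : ℝ) : ℂ)) ⇑f)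
              p volume := by
  obtain ⟨ε, hε, hχε⟩ := Metric.eventually_nhds_iff.1 hχ1
  obtain ⟨W, C, hW, hWe⟩ := W_bdd n (β / 2) hε
  have hC := hW.nonneg
  refine ⟨C + 1, by positivity, ?_⟩
  intro p hp f lam hlam
  obtain ⟨M, hM⟩ := hχc.exists_bound_of_continuous hχ.continuous
  have hχcont := hχ.continuous
  have hm2 : Integrable (fun ξ : EuclideanSpace ℝ (Fin n) =>
      (((1 - χ (lam * ‖ξ‖)) * (1 + lam ^ 2 * ‖ξ‖ ^ 2) ^ (-(β / 2)) : ℝ) : ℂ) * ft (⇑f) ξ) := by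
    refine (ft_integrable f).bdd_mul (c := 1 + M) ?_ (Filter.Eventually.of_forall fun ξ => ?_)
    · refine Continuous.aestronglyMeasurable ?_
      refine Complex.continuous_ofReal.comp (Continuous.mul (by fun_prop) ?_)
      refine Continuous.rpow_const (by fun_prop) fun ξ => Or.inl ?_
      positivity
    · rw [Complex.norm_real, norm_mul]
      have a1 : ‖1 - χ (lam * ‖ξ‖)‖ ≤ 1 + M :=
        (norm_sub_le _ _).trans (add_le_add (by simp) (hM _))
      have a2 : ‖(1 + lam ^ 2 * ‖ξ‖ ^ 2) ^ (-(β / 2))‖ ≤ 1 := by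
        rw [Real.norm_of_nonneg (by positivity)]
        exact Real.rpow_le_one_of_one_le_of_nonpos (by nlinarith [sq_nonneg (lam * ‖ξ‖)])
          (by linarith)
      calc _ ≤ (1 + M) * 1 := mul_le_mul a1 a2 (norm_nonneg _) ((norm_nonneg _).trans a1)
        _ = _ := mul_one _
  have key := hW.2.2 _ hm2 lam hlam p hp
  have heq : ∀ ξ : EuclideanSpace ℝ (Fin n),
      (((1 - χ (lam * ‖ξ‖)) / (lam * ‖ξ‖) ^ β : ℝ) : ℂ) * ft (⇑f) ξ =
      (W (lam • ξ) : ℂ) * ((((1 - χ (lam * ‖ξ‖)) *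
        (1 + lam ^ 2 * ‖ξ‖ ^ 2) ^ (-(β / 2)) : ℝ) : ℂ) * ft (⇑f) ξ) := by
    intro ξ
    rw [← mul_assoc, ← Complex.ofReal_mul]
    congr 2
    by_cases h : lam * ‖ξ‖ < ε
    · have : χ (lam * ‖ξ‖) = 1 := by
        apply hχε
        rw [dist_zero_right, Real.norm_of_nonneg (by positivity)]
        exact h
      simp [this]
    · push Not at h
      have hn' : ‖lam • ξ‖ = lam * ‖ξ‖ := by rw [norm_smul, Real.norm_of_nonneg hlam.le]
      rw [hWe _ (hn' ▸ h), hn', ← mul_pow]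
      set r := lam * ‖ξ‖ with hr
      have hr0 : 0 < r := hε.trans_le h
      have e1 : (1 + 1 / r ^ 2) ^ (β / 2) = (1 + r ^ 2) ^ (β / 2) / r ^ β := by
        rw [show 1 + 1 / r ^ 2 = (1 + r ^ 2) / r ^ 2 by field_simp; ring,
          Real.div_rpow (by positivity) (by positivity)]
        congr 1
        rw [← Real.rpow_natCast r 2, ← Real.rpow_mul hr0.le]
        congr 1; push_cast; ring
      have e2 : (1 + r ^ 2) ^ (-(β / 2)) = ((1 + r ^ 2) ^ (β / 2))⁻¹ :=
        Real.rpow_neg (by positivity) _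
      have e3 : (1 + r ^ 2) ^ (β / 2) ≠ 0 := by positivity
      rw [e1, e2]
      field_simp
  rw [fmult_eq, fmult_eq, eLpNorm_const_smul, eLpNorm_const_smul]
  simp only [heq]
  rw [mul_left_comm]
  gcongr
  refine key.trans ?_
  gcongr
  linarith
end

section
/- There exists a constant C > 0 such that for every Schwartz function f on ℝ one has ‖|D| f‖_{L¹(ℝ)} ≤ C (‖f‖_{L¹(ℝ)} + ‖f'‖_{L¹(ℝ)} + ‖f''‖_{L¹(ℝ)}). -/
open MeasureTheory Real Complex
open scoped ENNReal

/-- One-dimensional Fourier transform with the convention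
`f̂(ξ) = (2π)^{-1/2} ∫ e^{-i x ξ} f(x) dx`. -/
noncomputable def ft1 (f : ℝ → ℂ) (ξ : ℝ) : ℂ :=
  (((2 * π) ^ (-(1 : ℝ) / 2) : ℝ) : ℂ) * ∫ x : ℝ, Complex.exp (-Complex.I * (x * ξ : ℝ)) * f x

/-- One-dimensional Fourier multiplier `m(D) f (x) = (2π)^{-1/2} ∫ e^{i x ξ} m(ξ) f̂(ξ) dξ`. -/
noncomputable def fmult1 (m : ℝ → ℂ) (f : ℝ → ℂ) (x : ℝ) : ℂ :=
  (((2 * π) ^ (-(1 : ℝ) / 2) : ℝ) : ℂ) *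
    ∫ ξ : ℝ, Complex.exp (Complex.I * (x * ξ : ℝ)) * m ξ * ft1 f ξ

/-- translation difference bound -/
lemma aux_diff (g g' : ℝ → ℂ) (hg : ∀ x, HasDerivAt g (g' x) x) (hc : Continuous g')
    (y : ℝ) (hy : 0 ≤ y) :
    ∫⁻ x, ‖g (x + y) - g x‖ₑ ≤ ENNReal.ofReal y * ∫⁻ x, ‖g' x‖ₑ := by
  have h1 : ∀ x, ‖g (x + y) - g x‖ₑ ≤ ∫⁻ s in Set.Ioc 0 y, ‖g' (x + s)‖ₑ := by
    intro x
    have h := intervalIntegral.integral_eq_sub_of_hasDerivAt (f := fun s => g (x + s))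
      (f' := fun s => g' (x + s)) (a := 0) (b := y)
      (fun s _ => HasDerivAt.comp_const_add x s (hg (x + s)))
      ((hc.comp (continuous_const.add continuous_id)).intervalIntegrable _ _)
    simp only [add_zero] at h
    rw [← h, intervalIntegral.integral_of_le hy]
    exact enorm_integral_le_lintegral_enorm _
  calc ∫⁻ x, ‖g (x + y) - g x‖ₑ ≤ ∫⁻ x, ∫⁻ s in Set.Ioc 0 y, ‖g' (x + s)‖ₑ := lintegral_mono h1
    _ = ∫⁻ s in Set.Ioc 0 y, ∫⁻ x, ‖g' (x + s)‖ₑ := by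
        apply lintegral_lintegral_swap
        apply Measurable.aemeasurable
        apply Measurable.enorm
        exact (hc.comp (continuous_fst.add continuous_snd)).measurable
    _ = ∫⁻ s in Set.Ioc 0 y, ∫⁻ x, ‖g' x‖ₑ := by
        congr 1; ext s
        exact lintegral_add_right_eq_self (fun x => ‖g' x‖ₑ) s
    _ = _ := by
        rw [setLIntegral_const, Real.volume_Ioc, sub_zero, mul_comm]

noncomputable def auxΔ (f : ℝ → ℂ) (y x : ℝ) : ℂ := 2 * f x - f (x + y) - f (x - y)

lemma aux_delta1 (f : SchwartzMap ℝ ℂ) (y : ℝ) :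
    ∫⁻ x, ‖auxΔ f y x‖ₑ ≤ 4 * ∫⁻ x, ‖f x‖ₑ := by
  have hm : Measurable fun x => ‖f x‖ₑ := f.continuous.measurable.enorm
  have hf := f.continuous.measurable
  calc ∫⁻ x, ‖auxΔ f y x‖ₑ ≤ ∫⁻ x, (2 * ‖f x‖ₑ + ‖f (x + y)‖ₑ + ‖f (x - y)‖ₑ) := by
        apply lintegral_mono
        intro x
        unfold auxΔ
        refine (enorm_sub_le).trans (add_le_add ?_ le_rfl)
        refine (enorm_sub_le).trans (add_le_add ?_ le_rfl)
        rw [two_mul, two_mul]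
        exact enorm_add_le _ _
    _ = _ := by
        rw [lintegral_add_left (by fun_prop), lintegral_add_left (by fun_prop),
          lintegral_const_mul _ hm, lintegral_add_right_eq_self (fun x => ‖f x‖ₑ) y,
          lintegral_sub_right_eq_self (fun x => ‖f x‖ₑ) y]
        ring

lemma aux_hd (f : SchwartzMap ℝ ℂ) (x : ℝ) : HasDerivAt f (deriv f x) x :=
  f.differentiableAt.hasDerivAt

lemma aux_d (f : SchwartzMap ℝ ℂ) : deriv f = SchwartzMap.derivCLM ℂ ℂ f := by
  ext x; simp

lemma aux_delta2 (f : SchwartzMap ℝ ℂ) (y : ℝ) (hy : 0 ≤ y) :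
    ∫⁻ x, ‖auxΔ f y x‖ₑ ≤ ENNReal.ofReal y * (ENNReal.ofReal y * ∫⁻ x, ‖deriv (deriv f) x‖ₑ) := by
  have c1 : Continuous (deriv f) := by rw [aux_d]; exact SchwartzMap.continuous _
  have c2 : Continuous (deriv (deriv f)) := by
    rw [aux_d, aux_d]; exact SchwartzMap.continuous _
  have hd2 : ∀ x, HasDerivAt (deriv f) (deriv (deriv f) x) x := by
    intro x; rw [aux_d]; exact aux_hd _ x
  have A := aux_diff (deriv f) _ hd2 c2 y hy
  have B := aux_diff (fun x => f (x + y) - f x) (fun x => deriv f (x + y) - deriv f x)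
    (fun x => ((aux_hd f (x + y)).comp_add_const x y).sub (aux_hd f x)) (by fun_prop) y hy
  calc ∫⁻ x, ‖auxΔ f y x‖ₑ = ∫⁻ x, ‖auxΔ f y (x + y)‖ₑ :=
        (lintegral_add_right_eq_self (fun x => ‖auxΔ f y x‖ₑ) y).symm
    _ = ∫⁻ x, ‖f (x + y + y) - f (x + y) - (f (x + y) - f x)‖ₑ := by
        congr 1; ext x
        rw [← enorm_neg]
        congr 1
        unfold auxΔ
        rw [add_sub_cancel_right]
        ring
    _ ≤ _ := B.trans (by gcongr)

noncomputable def auxφ (u : ℝ) : ℝ := (2 - 2 * Real.cos u) / u ^ 2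

lemma auxφ_nonneg (u : ℝ) : 0 ≤ auxφ u := by
  unfold auxφ
  have := Real.cos_le_one u
  apply div_nonneg <;> nlinarith [sq_nonneg u]

lemma auxφ_meas : Measurable auxφ := by
  unfold auxφ; fun_prop

lemma auxφ_int : Integrable auxφ := by
  refine (integrable_inv_one_add_sq.const_mul 5).mono' auxφ_meas.aestronglyMeasurable ?_
  refine Filter.Eventually.of_forall fun u => ?_
  rw [Real.norm_of_nonneg (auxφ_nonneg u)]
  unfold auxφ
  by_cases h : u = 0
  · subst h; simp
  · have hu : 0 < u ^ 2 := by positivity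
    rw [← div_eq_mul_inv, div_le_div_iff₀ hu (by positivity)]
    have h1 := Real.neg_one_le_cos u
    have h2 := Real.one_sub_sq_div_two_le_cos (x := u)
    nlinarith

noncomputable def auxc : ℝ := ∫ u in Set.Ioi 0, auxφ u

lemma auxc_pos : 0 < auxc := by
  unfold auxc
  rw [setIntegral_pos_iff_support_of_nonneg_ae
    (Filter.Eventually.of_forall fun u => auxφ_nonneg u) auxφ_int.integrableOn]
  have : Set.Ioo (0:ℝ) 1 ⊆ Function.support auxφ ∩ Set.Ioi 0 := by
    intro u hu
    refine ⟨?_, hu.1⟩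
    have h : Real.cos u < Real.cos 0 :=
      Real.cos_lt_cos_of_nonneg_of_le_pi le_rfl (by linarith [Real.pi_gt_three, hu.2]) hu.1
    rw [Real.cos_zero] at h
    have hu0 := hu.1
    simp only [Function.mem_support]
    unfold auxφ
    exact (div_pos (by linarith) (by positivity)).ne'
  refine lt_of_lt_of_le ?_ (measure_mono this)
  simp

noncomputable def auxa (ξ y : ℝ) : ℝ := (2 - 2 * Real.cos (y * ξ)) / y ^ 2

lemma auxa_nonneg (ξ y : ℝ) : 0 ≤ auxa ξ y := by
  unfold auxa
  have := Real.cos_le_one (y * ξ)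
  apply div_nonneg <;> nlinarith [sq_nonneg y]

lemma auxa_eq (ξ y : ℝ) (h : ξ ≠ 0) : auxa ξ y = ξ ^ 2 * auxφ (|ξ| * y) := by
  unfold auxa auxφ
  have : Real.cos (|ξ| * y) = Real.cos (y * ξ) := by
    rcases abs_choice ξ with h | h <;> rw [h]
    · rw [mul_comm]
    · rw [neg_mul, Real.cos_neg, mul_comm]
  rw [this, mul_pow, sq_abs]
  field_simp

lemma auxa_int (ξ : ℝ) : IntegrableOn (auxa ξ) (Set.Ioi 0) := by
  by_cases h : ξ = 0
  · subst h
    have : auxa 0 = fun _ => 0 := by ext y; simp [auxa]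
    rw [this]; simp
  · have : auxa ξ = fun y => ξ ^ 2 * auxφ (|ξ| * y) := by ext y; exact auxa_eq ξ y h
    rw [this]
    exact ((auxφ_int.comp_mul_left' (abs_ne_zero.mpr h)).const_mul _).integrableOn

lemma auxa_integral (ξ : ℝ) : ∫ y in Set.Ioi 0, auxa ξ y = auxc * |ξ| := by
  by_cases h : ξ = 0
  · subst h
    simp [auxa]
  · have : auxa ξ = fun y => ξ ^ 2 * auxφ (|ξ| * y) := by ext y; exact auxa_eq ξ y h
    have hp : 0 < |ξ| := abs_pos.mpr h
    rw [this, integral_const_mul, integral_comp_mul_left_Ioi auxφ 0 hp, mul_zero, smul_eq_mul,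
      ← sq_abs ξ]
    change _ * (_ * auxc) = _
    field_simp

lemma ft1_eq (f : SchwartzMap ℝ ℂ) (ξ : ℝ) :
    ft1 f ξ = (((2 * π) ^ (-(1 : ℝ) / 2) : ℝ) : ℂ) * FourierTransform.fourier f (ξ * (2 * π)⁻¹) := by
  unfold ft1
  congr 1
  rw [SchwartzMap.fourier_coe, Real.fourier_eq']
  congr 1; ext x
  rw [smul_eq_mul]
  congr 2
  simp only [RCLike.inner_apply, conj_trivial]
  push_cast
  have : (π : ℂ) ≠ 0 := by exact_mod_cast Real.pi_ne_zero
  field_simp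

lemma aux_kk : (((2 * π) ^ (-(1 : ℝ) / 2) : ℝ) : ℂ) * (((2 * π) ^ (-(1 : ℝ) / 2) : ℝ) : ℂ)
    = (((2 * π)⁻¹ : ℝ) : ℂ) := by
  rw [← Complex.ofReal_mul, ← Real.rpow_add (by positivity)]
  norm_num [Real.rpow_neg_one]

lemma aux_inv (f : SchwartzMap ℝ ℂ) (x : ℝ) :
    (((2 * π) ^ (-(1 : ℝ) / 2) : ℝ) : ℂ) *
      ∫ ξ : ℝ, Complex.exp (Complex.I * (x * ξ : ℝ)) * ft1 f ξ = f x := by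
  have hinv : f x = ∫ w : ℝ, Complex.exp (Complex.I * (x * (w * (2 * π)) : ℝ)) *
      FourierTransform.fourier f w := by
    conv_lhs => rw [← FourierTransform.fourierInv_fourier_eq (F := SchwartzMap ℝ ℂ) f]
    rw [SchwartzMap.fourierInv_coe, Real.fourierInv_eq']
    congr 1; ext w
    rw [smul_eq_mul]
    congr 2
    simp only [RCLike.inner_apply, conj_trivial]
    push_cast
    ring
  have hcv := Measure.integral_comp_mul_right (fun w : ℝ =>
    Complex.exp (Complex.I * (x * (w * (2 * π)) : ℝ)) * FourierTransform.fourier f w) (2 * π)⁻¹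
  rw [← hinv] at hcv
  have hp : (2 * π) ≠ 0 := by positivity
  simp only [ft1_eq]
  have : ∀ ξ : ℝ, Complex.exp (Complex.I * (x * ξ : ℝ)) * ((((2 * π) ^ (-(1 : ℝ) / 2) : ℝ) : ℂ) *
      FourierTransform.fourier f (ξ * (2 * π)⁻¹)) = (((2 * π) ^ (-(1 : ℝ) / 2) : ℝ) : ℂ) *
      (Complex.exp (Complex.I * (x * (ξ * (2 * π)⁻¹ * (2 * π)) : ℝ)) *
        FourierTransform.fourier f (ξ * (2 * π)⁻¹)) := by
    intro ξ
    rw [inv_mul_cancel_right₀ hp]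
    ring
  simp only [this]
  rw [integral_const_mul, hcv, ← mul_assoc, aux_kk, inv_inv, abs_of_pos (by positivity),
    Complex.real_smul, ← mul_assoc, ← Complex.ofReal_mul, inv_mul_cancel₀ hp]
  simp

lemma ft1_cont (f : SchwartzMap ℝ ℂ) : Continuous (ft1 f) := by
  have : ft1 f = fun ξ => _ := funext (ft1_eq f)
  rw [this]
  have := (FourierTransform.fourier f).continuous
  fun_prop

lemma ft1_int (f : SchwartzMap ℝ ℂ) : Integrable (ft1 f) := by
  have : ft1 f = fun ξ => _ := funext (ft1_eq f)
  rw [this]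
  exact ((FourierTransform.fourier f).integrable.comp_mul_right' (by positivity)).const_mul _

lemma ft1_int' (f : SchwartzMap ℝ ℂ) : Integrable (fun ξ => |ξ| * ‖ft1 f ξ‖) := by
  have h := (FourierTransform.fourier f).integrable_pow_mul volume 1
  have h2 := (h.comp_mul_right' (R := (2 * π)⁻¹) (by positivity)).const_mul
    (‖(((2 * π) ^ (-(1 : ℝ) / 2) : ℝ) : ℂ)‖ * (2 * π))
  refine h2.congr (Filter.Eventually.of_forall fun ξ => ?_)
  have hp : (2 * π) ≠ 0 := by positivity
  simp only [ft1_eq, norm_mul, pow_one, Real.norm_eq_abs ξ]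
  rw [Real.norm_of_nonneg (r := (2 * π)⁻¹) (by positivity)]
  field_simp

lemma aux_exp_int (f : SchwartzMap ℝ ℂ) (x : ℝ) :
    Integrable (fun ξ : ℝ => Complex.exp (Complex.I * (x * ξ : ℝ)) * ft1 f ξ) := by
  refine (ft1_int f).norm.mono' ?_ (Filter.Eventually.of_forall fun ξ => ?_)
  · have := ft1_cont f
    exact Continuous.aestronglyMeasurable (by fun_prop)
  · rw [norm_mul, mul_comm Complex.I, Complex.norm_exp_ofReal_mul_I, one_mul]

lemma aux_inner (f : SchwartzMap ℝ ℂ) (x y : ℝ) :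
    (((2 * π) ^ (-(1 : ℝ) / 2) : ℝ) : ℂ) *
      ∫ ξ : ℝ, Complex.exp (Complex.I * (x * ξ : ℝ)) * (auxa ξ y : ℝ) * ft1 f ξ
      = ((y ^ 2)⁻¹ : ℝ) * auxΔ f y x := by
  have : ∀ ξ : ℝ, Complex.exp (Complex.I * (x * ξ : ℝ)) * (auxa ξ y : ℝ) * ft1 f ξ =
      ((y ^ 2)⁻¹ : ℝ) * (2 * (Complex.exp (Complex.I * (x * ξ : ℝ)) * ft1 f ξ) -
        Complex.exp (Complex.I * ((x + y) * ξ : ℝ)) * ft1 f ξ -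
        Complex.exp (Complex.I * ((x - y) * ξ : ℝ)) * ft1 f ξ) := by
    intro ξ
    have e1 : Complex.exp (Complex.I * ((x + y) * ξ : ℝ)) =
      Complex.exp (Complex.I * (x * ξ : ℝ)) * Complex.exp ((y * ξ : ℝ) * Complex.I) := by
      rw [← Complex.exp_add]; congr 1; push_cast; ring
    have e2 : Complex.exp (Complex.I * ((x - y) * ξ : ℝ)) =
      Complex.exp (Complex.I * (x * ξ : ℝ)) * Complex.exp (-(y * ξ : ℝ) * Complex.I) := by
      rw [← Complex.exp_add]; congr 1; push_cast; ring
    have e3 := Complex.two_cos ((y * ξ : ℝ) : ℂ)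
    rw [e1, e2]
    unfold auxa
    rw [div_eq_mul_inv]
    have e4 : (((2 - 2 * Real.cos (y * ξ)) * (y ^ 2)⁻¹ : ℝ) : ℂ) =
        (2 - 2 * Complex.cos ((y * ξ : ℝ) : ℂ)) * ((y ^ 2)⁻¹ : ℝ) := by
      push_cast; ring
    rw [e4, e3]
    ring
  simp only [this]
  have i1 := aux_exp_int f x
  have i2 := aux_exp_int f (x + y)
  have i3 := aux_exp_int f (x - y)
  have i4 : Integrable (fun ξ : ℝ => 2 * (Complex.exp (Complex.I * (x * ξ : ℝ)) * ft1 f ξ) -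
        Complex.exp (Complex.I * ((x + y) * ξ : ℝ)) * ft1 f ξ) := (i1.const_mul 2).sub i2
  rw [integral_const_mul, integral_sub i4 i3,
    integral_sub (i1.const_mul 2) i2, integral_const_mul]
  unfold auxΔ
  rw [← aux_inv f x, ← aux_inv f (x + y), ← aux_inv f (x - y)]
  ring

lemma aux_prod (f : SchwartzMap ℝ ℂ) (x : ℝ) :
    Integrable (fun p : ℝ × ℝ =>
      Complex.exp (Complex.I * (x * p.1 : ℝ)) * (auxa p.1 p.2 : ℝ) * ft1 f p.1)
      ((volume : Measure ℝ).prod (volume.restrict (Set.Ioi 0))) := by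
  have hF := (ft1_cont f).measurable
  have hn : ∀ ξ y : ℝ, ‖Complex.exp (Complex.I * (x * ξ : ℝ)) * (auxa ξ y : ℝ) * ft1 f ξ‖
      = auxa ξ y * ‖ft1 f ξ‖ := by
    intro ξ y
    rw [norm_mul, norm_mul, mul_comm Complex.I, Complex.norm_exp_ofReal_mul_I, one_mul,
      Complex.norm_real, Real.norm_of_nonneg (auxa_nonneg _ _)]
  rw [integrable_prod_iff]
  · constructor
    · refine Filter.Eventually.of_forall fun ξ => ?_
      have hh : Integrable (fun y => ((auxa ξ y : ℝ) : ℂ)) (volume.restrict (Set.Ioi 0)) :=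
        Integrable.ofReal (auxa_int ξ)
      have gen : ∀ a b : ℂ, Integrable (fun y => a * ((auxa ξ y : ℝ) : ℂ) * b)
          (volume.restrict (Set.Ioi 0)) := fun a b => (hh.const_mul a).mul_const b
      exact gen (Complex.exp (Complex.I * (x * ξ : ℝ))) (ft1 f ξ)
    · have e : (fun ξ : ℝ => ∫ y in Set.Ioi 0,
          ‖Complex.exp (Complex.I * (x * ξ : ℝ)) * (auxa ξ y : ℝ) * ft1 f ξ‖) =
          fun ξ => auxc * (|ξ| * ‖ft1 f ξ‖) := by
        ext ξ
        simp only [hn]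
        rw [integral_mul_const, auxa_integral, mul_assoc]
      have e' := (ft1_int' f).const_mul auxc
      rw [← e] at e'
      exact e'
  · apply Measurable.aestronglyMeasurable
    unfold auxa
    fun_prop

lemma aux_formula (f : SchwartzMap ℝ ℂ) (x : ℝ) :
    (auxc : ℂ) * fmult1 (fun ξ => ((|ξ| : ℝ) : ℂ)) f x =
      ∫ y in Set.Ioi 0, ((y ^ 2)⁻¹ : ℝ) * auxΔ f y x := by
  simp only [← aux_inner]
  rw [integral_const_mul, ← integral_integral_swap (aux_prod f x)]
  unfold fmult1
  rw [mul_left_comm, ← integral_const_mul]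
  congr 2; ext ξ
  rw [integral_mul_const, integral_const_mul, integral_complex_ofReal, auxa_integral]
  push_cast
  ring

lemma aux_bound (f : SchwartzMap ℝ ℂ) :
    ENNReal.ofReal auxc * eLpNorm (fmult1 (fun ξ => ((|ξ| : ℝ) : ℂ)) f) 1 volume ≤
      (4 * eLpNorm f 1 volume + eLpNorm (deriv (deriv f)) 1 volume) * ENNReal.ofReal π := by
  simp only [eLpNorm_one_eq_lintegral_enorm]
  set A := ∫⁻ x, ‖f x‖ₑ
  set B := ∫⁻ x, ‖deriv (deriv f) x‖ₑ
  have hfm := f.continuous.measurable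
  calc _ = ∫⁻ x, ‖(auxc : ℂ) * fmult1 (fun ξ => ((|ξ| : ℝ) : ℂ)) f x‖ₑ := by
        rw [← lintegral_const_mul' _ _ ENNReal.ofReal_ne_top]
        congr 1; ext x
        rw [enorm_mul, ← ofReal_norm (auxc : ℂ), Complex.norm_real,
          Real.norm_of_nonneg auxc_pos.le]
    _ ≤ ∫⁻ x, ∫⁻ y in Set.Ioi 0, ENNReal.ofReal (y ^ 2)⁻¹ * ‖auxΔ f y x‖ₑ := by
        apply lintegral_mono
        intro x
        simp only [aux_formula]
        refine (enorm_integral_le_lintegral_enorm _).trans (le_of_eq ?_)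
        congr 1; ext y
        rw [enorm_mul, ← ofReal_norm (((y ^ 2)⁻¹ : ℝ) : ℂ), Complex.norm_real,
          Real.norm_of_nonneg (by positivity)]
    _ = ∫⁻ y in Set.Ioi 0, ∫⁻ x, ENNReal.ofReal (y ^ 2)⁻¹ * ‖auxΔ f y x‖ₑ := by
        apply lintegral_lintegral_swap
        apply Measurable.aemeasurable
        unfold Function.uncurry auxΔ
        fun_prop
    _ ≤ ∫⁻ y in Set.Ioi 0, (4 * A + B) * ENNReal.ofReal (1 + y ^ 2)⁻¹ := by
        apply setLIntegral_mono' measurableSet_Ioi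
        intro y hy
        have hy : 0 < y := hy
        rw [lintegral_const_mul' _ _ ENNReal.ofReal_ne_top]
        have h1 := aux_delta1 f y
        have h2 := aux_delta2 f y hy.le
        set D := ∫⁻ x, ‖auxΔ f y x‖ₑ
        have e : (y ^ 2)⁻¹ = (1 + (y ^ 2)⁻¹) * (1 + y ^ 2)⁻¹ := by
          field_simp; ring
        rw [e, ENNReal.ofReal_mul (by positivity), mul_right_comm]
        gcongr
        rw [ENNReal.ofReal_add (by positivity) (by positivity), ENNReal.ofReal_one, add_mul, one_mul]
        gcongr
        calc ENNReal.ofReal (y ^ 2)⁻¹ * D ≤ ENNReal.ofReal (y ^ 2)⁻¹ *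
              (ENNReal.ofReal y * (ENNReal.ofReal y * B)) := by gcongr
          _ = B := by
            rw [← mul_assoc, ← mul_assoc, ← ENNReal.ofReal_mul (by positivity),
              ← ENNReal.ofReal_mul (by positivity)]
            have : (y ^ 2)⁻¹ * y * y = 1 := by field_simp
            rw [this]; simp
    _ ≤ ∫⁻ y, (4 * A + B) * ENNReal.ofReal (1 + y ^ 2)⁻¹ := setLIntegral_le_lintegral _ _
    _ = _ := by
        rw [lintegral_const_mul _ (by fun_prop), ← ofReal_integral_eq_lintegral_ofReal
          integrable_inv_one_add_sq (Filter.Eventually.of_forall fun y => by positivity),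
          integral_univ_inv_one_add_sq]

/-- `‖|D| f‖_{L¹(ℝ)} ≤ C ‖f‖_{W^{2,1}(ℝ)}` (Lemma B.4, second bound). -/
theorem stmt8 :
    ∃ C : ℝ, 0 < C ∧ ∀ f : SchwartzMap ℝ ℂ,
      eLpNorm (fmult1 (fun ξ => ((|ξ| : ℝ) : ℂ)) ⇑f) 1 volume ≤
        ENNReal.ofReal C *
          (eLpNorm (⇑f) 1 volume + eLpNorm (deriv ⇑f) 1 volume +
            eLpNorm (deriv (deriv ⇑f)) 1 volume) := by
  have hc := auxc_pos
  refine ⟨auxc⁻¹ * (4 * π), by positivity, fun f => ?_⟩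
  have h := aux_bound f
  set N := eLpNorm (fmult1 (fun ξ => ((|ξ| : ℝ) : ℂ)) ⇑f) 1 volume
  set A := eLpNorm (⇑f) 1 volume
  set A' := eLpNorm (deriv ⇑f) 1 volume
  set B := eLpNorm (deriv (deriv ⇑f)) 1 volume
  have hB : B ≤ 4 * B := le_mul_of_one_le_left (zero_le) (by norm_num)
  calc N = ENNReal.ofReal auxc⁻¹ * (ENNReal.ofReal auxc * N) := by
        rw [← mul_assoc, ← ENNReal.ofReal_mul (by positivity), inv_mul_cancel₀ hc.ne']
        simp
    _ ≤ ENNReal.ofReal auxc⁻¹ * ((4 * (A + A') + 4 * B) * ENNReal.ofReal π) := by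
        refine mul_le_mul_right (h.trans ?_) _
        gcongr
        exact le_self_add
    _ = _ := by
        rw [ENNReal.ofReal_mul (by positivity), ENNReal.ofReal_mul (by positivity)]
        simp only [ENNReal.ofReal_ofNat]
        ring
end

section
/- Let s ∈ [0,2]. There exists a constant C > 0 such that for every Schwartz function f on ℝ² one has ‖|D|^s f‖_{L¹(ℝ²)} ≤ C Σ_{|γ| ≤ 2} ‖∂^γ f‖_{L¹(ℝ²)}, where the sum runs over multi-indices γ ∈ ℕ² of order at most 2. -/
open MeasureTheory Real Complex
open scoped ENNReal InnerProductSpace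

/-- Partial derivative in the `i`-th coordinate direction of `ℝ²`. -/
noncomputable def pd (i : Fin 2) (f : EuclideanSpace ℝ (Fin 2) → ℂ) :
    EuclideanSpace ℝ (Fin 2) → ℂ :=
  fun x => fderiv ℝ f x (EuclideanSpace.single i 1)

/-- Iterated partial derivative `∂^γ = ∂₁^{γ₁} ∂₂^{γ₂}` on `ℝ²`. -/
noncomputable def pdm (a b : ℕ) (f : EuclideanSpace ℝ (Fin 2) → ℂ) :
    EuclideanSpace ℝ (Fin 2) → ℂ :=
  (pd 0)^[a] ((pd 1)^[b] f)


abbrev E2 := EuclideanSpace ℝ (Fin 2)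
open scoped FourierTransform LineDeriv SchwartzMap

lemma ft_eq (f : E2 → ℂ) (ξ : E2) :
    ft f ξ = (((2 * π)⁻¹ : ℝ) : ℂ) * 𝓕 f ((2 * π)⁻¹ • ξ) := by
  rw [ft, Real.fourier_eq']
  congr 2
  · norm_num [Real.rpow_neg_one]
  · ext v
    rw [smul_eq_mul]
    congr 2
    rw [real_inner_smul_right]
    have : (π : ℝ) ≠ 0 := Real.pi_ne_zero
    have h2 : (-2 * π * ((2 * π)⁻¹ * ⟪v, ξ⟫_ℝ)) = - ⟪v, ξ⟫_ℝ := by field_simp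
    rw [h2]
    push_cast; ring

lemma fmult_eq_s9 (m : E2 → ℂ) (f : E2 → ℂ) (x : E2) :
    fmult m f x = ∫ η : E2, Complex.exp ((2 * π * ⟪η, x⟫_ℝ : ℝ) * Complex.I) *
      (m ((2 * π) • η) * 𝓕 f η) := by
  have hpi : (π : ℝ) ≠ 0 := Real.pi_ne_zero
  have h := Measure.integral_comp_smul (volume : Measure E2)
    (fun ξ : E2 => Complex.exp (Complex.I * (⟪x, ξ⟫_ℝ : ℂ)) * m ξ * ft f ξ) (2 * π)
  have h3 : |((2 * π) ^ Module.finrank ℝ E2)⁻¹| = ((2 * π)^2)⁻¹ := by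
    rw [finrank_euclideanSpace_fin, abs_of_nonneg (by positivity)]
  rw [h3] at h
  rw [fmult]
  have h4 : ((((2 * π) ^ (-((2:ℕ) : ℝ) / 2) : ℝ) : ℂ)) = (((2*π : ℝ) : ℂ)) * ((((2 * π)^2)⁻¹ : ℝ) : ℂ) := by
    rw [← Complex.ofReal_mul]
    congr 1
    norm_num [Real.rpow_neg_one]
    field_simp
  rw [h4, mul_assoc, ← Complex.real_smul (x := ((2 * π)^2)⁻¹), ← h, ← integral_const_mul]
  congr 1
  ext η
  rw [ft_eq, smul_smul, inv_mul_cancel₀ (by positivity), one_smul, real_inner_smul_right, real_inner_comm x η]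
  have : (((2 * π)⁻¹ : ℝ) : ℂ) = (((2 * π) : ℝ) : ℂ)⁻¹ := by push_cast; rfl
  rw [this]
  have : (((2 * π) : ℝ) : ℂ) ≠ 0 := by exact_mod_cast (by positivity : (2*π) ≠ 0)
  field_simp

/-- Fourier inversion. -/
lemma inv_formula (f : 𝓢(E2, ℂ)) (x : E2) :
    ∫ η : E2, Complex.exp ((2 * π * ⟪η, x⟫_ℝ : ℝ) * Complex.I) * 𝓕 (f : E2 → ℂ) η = f x := by
  have h := FourierTransform.fourierInv_fourier_eq (F := 𝓢(E2, ℂ)) f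
  have h2 := congrArg (fun g : 𝓢(E2, ℂ) => g x) h
  simp only [SchwartzMap.fourierInv_coe, SchwartzMap.fourier_coe] at h2
  rw [Real.fourierInv_eq'] at h2
  simpa using h2

lemma case_zero (f : 𝓢(E2, ℂ)) (x : E2) :
    fmult (fun ξ => ((‖ξ‖ ^ (0:ℝ) : ℝ) : ℂ)) f x = f x := by
  rw [fmult_eq_s9, ← inv_formula f x]
  simp

lemma pd_eq (i : Fin 2) (f : 𝓢(E2, ℂ)) : pd i f = ⇑(∂_{(EuclideanSpace.single i (1:ℝ) : E2)} f : 𝓢(E2, ℂ)) := by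
  ext x
  rw [SchwartzMap.lineDerivOp_apply_eq_fderiv]; rfl

open Laplacian in
lemma case_two (f : 𝓢(E2, ℂ)) (x : E2) :
    fmult (fun ξ => ((‖ξ‖ ^ (2:ℝ) : ℝ) : ℂ)) f x = - (pdm 2 0 f x + pdm 0 2 f x) := by
  have h := SchwartzMap.laplacian_eq_fourierMultiplierCLM f
  have h2 := congrArg (fun g : 𝓢(E2, ℂ) => g x) h
  simp only [SchwartzMap.laplacian_eq_sum (EuclideanSpace.basisFun (Fin 2) ℝ)] at h2
  have h3 : pdm 2 0 f x + pdm 0 2 f x = -(2 * π) ^ 2 •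
      (SchwartzMap.fourierMultiplierCLM ℂ (fun x : E2 => ‖x‖ ^ 2) f) x := by
    simp only [pdm, Function.iterate_succ, Function.iterate_zero, Function.comp_apply, id, pd_eq]
    simpa [Fin.sum_univ_two] using h2
  rw [h3, SchwartzMap.fourierMultiplierCLM_apply, SchwartzMap.fourierInv_coe, Real.fourierInv_eq', fmult_eq_s9,
    ← integral_smul, ← integral_neg]
  congr 1
  ext η
  rw [SchwartzMap.smulLeftCLM_apply_apply (by fun_prop)]
  simp [SchwartzMap.fourier_coe, norm_smul, abs_of_nonneg Real.pi_pos.le]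
  ring

open Set in
lemma integrable_weight (s : ℝ) (hs0 : 0 < s) (hs2 : s < 2) :
    Integrable (fun y : E2 => min 1 (‖y‖ ^ 2) * ‖y‖ ^ (-2 - s)) := by
  rw [integrable_fun_norm_addHaar (volume : Measure E2) (f := fun r => min 1 (r ^ 2) * r ^ (-2 - s))]
  rw [finrank_euclideanSpace_fin, ← Ioc_union_Ioi_eq_Ioi (zero_le_one' ℝ)]
  apply IntegrableOn.union
  · have h := (intervalIntegral.intervalIntegrable_rpow' (a := 0) (b := 1) (r := 1 - s) (by linarith))
    rw [intervalIntegrable_iff_integrableOn_Ioc_of_le zero_le_one] at h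
    refine h.congr_fun ?_ measurableSet_Ioc
    intro r hr
    have h1 : r ^ 2 ≤ 1 := by nlinarith [hr.1, hr.2]
    simp only [smul_eq_mul, min_eq_right h1]
    rw [← mul_assoc, show (2 - 1 : ℕ) = 1 from rfl, ← Real.rpow_natCast, ← Real.rpow_natCast, ← Real.rpow_add hr.1, ← Real.rpow_add hr.1]
    congr 1; push_cast; ring
  · have h := integrableOn_Ioi_rpow_of_lt (a := -1 - s) (c := 1) (by linarith) one_pos
    refine h.congr_fun ?_ measurableSet_Ioi
    intro r hr
    have hr : 1 < r := hr
    have h1 : 1 ≤ r ^ 2 := by nlinarith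
    simp only [smul_eq_mul, min_eq_left h1]
    rw [show (2 - 1 : ℕ) = 1 from rfl, one_mul, pow_one, ← Real.rpow_one_add' (by positivity) (by linarith)]
    congr 1; ring

lemma cos_bound (y ξ : E2) : 1 - Real.cos ⟪y, ξ⟫_ℝ ≤ (2 + ‖ξ‖ ^ 2) * min 1 (‖y‖ ^ 2) := by
  have h1 := Real.one_sub_sq_div_two_le_cos (x := ⟪y, ξ⟫_ℝ)
  have h2 := Real.neg_one_le_cos ⟪y, ξ⟫_ℝ
  have h3 : ⟪y, ξ⟫_ℝ ^ 2 ≤ ‖y‖ ^ 2 * ‖ξ‖ ^ 2 := by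
    rw [← mul_pow, ← sq_abs]
    exact pow_le_pow_left₀ (abs_nonneg _) (abs_real_inner_le_norm y ξ) 2
  rcases le_total 1 (‖y‖ ^ 2) with h | h
  · rw [min_eq_left h]; nlinarith [sq_nonneg ‖ξ‖]
  · rw [min_eq_right h]; nlinarith [sq_nonneg ‖ξ‖, sq_nonneg ‖y‖, mul_nonneg (sq_nonneg ‖y‖) (sq_nonneg ‖ξ‖)]

lemma meas_weight (s : ℝ) : Measurable (fun y : E2 => ‖y‖ ^ (-2 - s)) :=
  measurable_norm.pow_const _

lemma integrable_K (s : ℝ) (hs0 : 0 < s) (hs2 : s < 2) (ξ : E2) :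
    Integrable (fun y : E2 => (1 - Real.cos ⟪y, ξ⟫_ℝ) * ‖y‖ ^ (-2 - s)) := by
  refine ((integrable_weight s hs0 hs2).const_mul (2 + ‖ξ‖ ^ 2)).mono' ?_ ?_
  · apply Measurable.aestronglyMeasurable
    exact (by fun_prop : Measurable (fun y : E2 => 1 - Real.cos ⟪y, ξ⟫_ℝ)).mul (meas_weight s)
  · filter_upwards with y
    have h0 : 0 ≤ ‖y‖ ^ (-2 - s) := by positivity
    have h1 := Real.cos_le_one ⟪y, ξ⟫_ℝ
    rw [Real.norm_of_nonneg (mul_nonneg (by linarith) h0), ← mul_assoc]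
    exact mul_le_mul_of_nonneg_right (cos_bound y ξ) h0

noncomputable def Kf (s : ℝ) (ξ : E2) : ℝ := ∫ y : E2, (1 - Real.cos ⟪y, ξ⟫_ℝ) * ‖y‖ ^ (-2 - s)

lemma Kf_isometry (s : ℝ) (R : E2 ≃ₗᵢ[ℝ] E2) (ξ : E2) : Kf s (R ξ) = Kf s ξ := by
  unfold Kf
  rw [← R.measurePreserving.integral_comp R.toHomeomorph.measurableEmbedding]
  simp

lemma Kf_smul (s : ℝ) (r : ℝ) (hr : 0 < r) (ξ : E2) : Kf s (r • ξ) = r ^ s * Kf s ξ := by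
  have h := Measure.integral_comp_smul (volume : Measure E2)
    (fun y : E2 => (1 - Real.cos ⟪y, ξ⟫_ℝ) * ‖y‖ ^ (-2 - s)) r
  rw [finrank_euclideanSpace_fin, abs_of_nonneg (by positivity)] at h
  have h2 : Kf s (r • ξ) = r ^ (2 + s) * ∫ y : E2, (1 - Real.cos ⟪r • y, ξ⟫_ℝ) * ‖r • y‖ ^ (-2 - s) := by
    rw [← integral_const_mul]
    unfold Kf
    congr 1
    ext y
    rw [real_inner_smul_right, real_inner_smul_left, norm_smul, Real.norm_of_nonneg hr.le,
      Real.mul_rpow hr.le (norm_nonneg _)]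
    have : r ^ (2 + s) * r ^ (-2 - s) = 1 := by
      rw [← Real.rpow_add hr]; simp
    calc _ = (r ^ (2 + s) * r ^ (-2 - s)) * ((1 - Real.cos (r * ⟪y, ξ⟫_ℝ)) * ‖y‖ ^ (-2 - s)) := by rw [this, one_mul]
      _ = _ := by ring
  rw [h2, h, smul_eq_mul, ← mul_assoc]
  congr 1
  rw [Real.rpow_add hr]
  norm_num
  field_simp

noncomputable def e0 : E2 := EuclideanSpace.single 0 1

lemma norm_e0 : ‖e0‖ = 1 := by simp [e0]

lemma Kf_eq (s : ℝ) (hs0 : 0 < s) (ξ : E2) : Kf s ξ = ‖ξ‖ ^ s * Kf s e0 := by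
  rcases eq_or_ne ξ 0 with h | h
  · subst h
    simp [Kf, Real.zero_rpow hs0.ne']
  · have hn : 0 < ‖ξ‖ := norm_pos_iff.mpr h
    rw [← Kf_smul s _ hn]
    have h1 : ‖ξ‖ = ‖‖ξ‖ • e0‖ := by simp [norm_smul, norm_e0]
    have h2 := Submodule.reflection_sub h1
    conv_rhs => rw [← h2]
    rw [Kf_isometry]

lemma Kf_pos (s : ℝ) (hs0 : 0 < s) (hs2 : s < 2) : 0 < Kf s e0 := by
  unfold Kf
  have hnn : ∀ y : E2, 0 ≤ (1 - Real.cos ⟪y, e0⟫_ℝ) * ‖y‖ ^ (-2 - s) := fun y =>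
    mul_nonneg (by linarith [Real.cos_le_one ⟪y, e0⟫_ℝ]) (by positivity)
  rw [integral_pos_iff_support_of_nonneg hnn (integrable_K s hs0 hs2 e0)]
  have hopen : IsOpen {y : E2 | 0 < ⟪y, e0⟫_ℝ ∧ ⟪y, e0⟫_ℝ < 2} :=
    (isOpen_Ioo (a := (0:ℝ)) (b := 2)).preimage (by fun_prop : Continuous fun y : E2 => ⟪y, e0⟫_ℝ)
  have hne : {y : E2 | 0 < ⟪y, e0⟫_ℝ ∧ ⟪y, e0⟫_ℝ < 2}.Nonempty :=
    ⟨e0, by simp [norm_e0]⟩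
  refine (hopen.measure_pos volume hne).trans_le (measure_mono ?_)
  intro y hy
  have hy1 : 0 < ⟪y, e0⟫_ℝ := hy.1
  have hy2 : ⟪y, e0⟫_ℝ < 2 := hy.2
  have hy0 : y ≠ 0 := by rintro rfl; simp at hy1
  have hc : Real.cos ⟪y, e0⟫_ℝ < 1 := by
    rw [← Real.cos_zero]
    exact Real.cos_lt_cos_of_nonneg_of_le_pi le_rfl (by linarith [Real.pi_gt_three]) hy1
  have : 0 < ‖y‖ ^ (-2 - s) := Real.rpow_pos_of_pos (norm_pos_iff.mpr hy0) _
  exact (mul_pos (by linarith) this).ne'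

lemma diff_bound (g : E2 → ℂ) (hg : ContDiff ℝ 1 g) (y : E2) :
    ∫⁻ x, ‖g (x + y) - g x‖ₑ ≤ ∫⁻ x, ‖fderiv ℝ g x y‖ₑ := by
  have hc : Continuous (fun x => fderiv ℝ g x y) :=
    (hg.continuous_fderiv one_ne_zero).clm_apply continuous_const
  have h1 : ∀ x, ‖g (x + y) - g x‖ₑ ≤ ∫⁻ t in Set.Ioc (0:ℝ) 1, ‖fderiv ℝ g (x + t • y) y‖ₑ := by
    intro x
    have hd : ∀ t ∈ Set.uIcc (0:ℝ) 1, HasDerivAt (fun t : ℝ => g (x + t • y)) (fderiv ℝ g (x + t • y) y) t := by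
      intro t _
      have h := (hg.differentiable one_ne_zero (x + t • y)).hasFDerivAt
      have h2 : HasDerivAt (fun t : ℝ => x + t • y) y t := by
        simpa using ((hasDerivAt_id t).smul_const y).const_add x
      exact h.comp_hasDerivAt t h2
    have hi := intervalIntegral.integral_eq_sub_of_hasDerivAt hd
      (Continuous.intervalIntegrable (by fun_prop) _ _)
    simp only [one_smul, zero_smul, add_zero] at hi
    rw [← hi, intervalIntegral.integral_of_le zero_le_one]
    exact enorm_integral_le_lintegral_enorm _
  calc ∫⁻ x, ‖g (x + y) - g x‖ₑ ≤ ∫⁻ x, ∫⁻ t in Set.Ioc (0:ℝ) 1, ‖fderiv ℝ g (x + t • y) y‖ₑ :=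
        lintegral_mono h1
    _ = ∫⁻ t in Set.Ioc (0:ℝ) 1, ∫⁻ x, ‖fderiv ℝ g (x + t • y) y‖ₑ := by
        apply lintegral_lintegral_swap
        apply Measurable.aemeasurable
        apply Continuous.measurable
        simp only [Function.uncurry_def]
        fun_prop
    _ = ∫⁻ t in Set.Ioc (0:ℝ) 1, ∫⁻ x, ‖fderiv ℝ g x y‖ₑ := by
        congr 1; ext t
        exact lintegral_add_right_eq_self (fun x => ‖fderiv ℝ g x y‖ₑ) (t • y)
    _ = _ := by simp

lemma diff2_bound (f : 𝓢(E2, ℂ)) (y : E2) :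
    ∫⁻ x, ‖f (x + y) + f (x - y) - 2 * f x‖ₑ ≤ ∫⁻ x, ‖(∂_{y} (∂_{y} f) : 𝓢(E2, ℂ)) x‖ₑ := by
  have hf : ContDiff ℝ 1 f := f.smooth 1
  have h1 := diff_bound (fun x => f x - f (x - y)) (by fun_prop) y
  have h2 := diff_bound (∂_{y} f : 𝓢(E2, ℂ)) (SchwartzMap.smooth _ 1) y
  calc _ = ∫⁻ x, ‖(f (x + y) - f (x + y - y)) - (f x - f (x - y))‖ₑ := by
        congr 1; ext x; congr 1; rw [add_sub_cancel_right]; ring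
    _ ≤ _ := h1
    _ = ∫⁻ x, ‖(∂_{y} f : 𝓢(E2, ℂ)) x - (∂_{y} f : 𝓢(E2, ℂ)) (x - y)‖ₑ := by
        congr 1; ext x; congr 1
        have hd : Differentiable ℝ f := hf.differentiable one_ne_zero
        rw [fderiv_fun_sub (hd x) (by fun_prop), fderiv_comp_sub]
        simp [SchwartzMap.lineDerivOp_apply_eq_fderiv]
    _ = ∫⁻ x, ‖(∂_{y} f : 𝓢(E2, ℂ)) (x + y) - (∂_{y} f : 𝓢(E2, ℂ)) x‖ₑ := by
        rw [← lintegral_add_right_eq_self _ y]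
        simp
    _ ≤ _ := h2
    _ = _ := by simp [SchwartzMap.lineDerivOp_apply_eq_fderiv]

lemma lineDeriv_decomp (f : 𝓢(E2, ℂ)) (y x : E2) :
    (∂_{y} f : 𝓢(E2, ℂ)) x = (y 0 : ℂ) * pd 0 f x + (y 1 : ℂ) * pd 1 f x := by
  have hy : y = y 0 • EuclideanSpace.single 0 (1:ℝ) + y 1 • EuclideanSpace.single 1 (1:ℝ) := by
    ext i; fin_cases i <;> simp
  rw [SchwartzMap.lineDerivOp_apply_eq_fderiv]
  conv_lhs => rw [hy, map_add, map_smul, map_smul]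
  simp [pd]

lemma pd_comm (f : 𝓢(E2, ℂ)) (x : E2) : pd 1 (pd 0 f) x = pd 0 (pd 1 f) x := by
  have hd : DifferentiableAt ℝ (fderiv ℝ f) x :=
    ((f.smooth 2).fderiv_right (m := 1) (by norm_num)).differentiable one_ne_zero x
  have hs : IsSymmSndFDerivAt ℝ f x := (f.smooth 2).contDiffAt.isSymmSndFDerivAt (by simp)
  have key : ∀ i j : Fin 2, pd i (pd j f) x = fderiv ℝ (fderiv ℝ f) x (EuclideanSpace.single i 1) (EuclideanSpace.single j 1) := by
    intro i j
    unfold pd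
    rw [fderiv_clm_apply hd (by fun_prop)]
    simp
  rw [key, key]
  exact hs.eq _ _

lemma lineDeriv_decomp2 (f : 𝓢(E2, ℂ)) (y x : E2) :
    (∂_{y} (∂_{y} f) : 𝓢(E2, ℂ)) x = (y 0 : ℂ) ^ 2 * pdm 2 0 f x +
      (y 0 : ℂ) * (y 1 : ℂ) * (2 * pdm 1 1 f x) + (y 1 : ℂ) ^ 2 * pdm 0 2 f x := by
  have h : (∂_{y} f : 𝓢(E2, ℂ)) = y 0 • (∂_{(EuclideanSpace.single 0 (1:ℝ) : E2)} f : 𝓢(E2, ℂ)) +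
      y 1 • (∂_{(EuclideanSpace.single 1 (1:ℝ) : E2)} f : 𝓢(E2, ℂ)) := by
    ext z
    rw [lineDeriv_decomp, pd_eq, pd_eq]
    simp
  have h2 : ∀ i, pd i (∂_{y} f : 𝓢(E2, ℂ)) x = (y 0 : ℂ) * pd i (pd 0 f) x + (y 1 : ℂ) * pd i (pd 1 f) x := by
    intro i
    rw [pd_eq, pd_eq, pd_eq, pd_eq, pd_eq, h, LineDeriv.lineDerivOp_add, LineDeriv.lineDerivOp_smul, LineDeriv.lineDerivOp_smul]
    simp
  rw [lineDeriv_decomp, h2, h2, pd_comm]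
  simp only [pdm, Function.iterate_succ, Function.iterate_zero, Function.comp_apply, id]
  ring

lemma cont_pd (i : Fin 2) (f : 𝓢(E2, ℂ)) : Continuous (pd i f) := by
  rw [pd_eq]; exact SchwartzMap.continuous _

lemma cont_pd2 (i j : Fin 2) (f : 𝓢(E2, ℂ)) : Continuous (pd i (pd j f)) := by
  rw [pd_eq]; exact cont_pd _ _

lemma diff2_bound' (f : 𝓢(E2, ℂ)) (y : E2) :
    ∫⁻ x, ‖f (x + y) + f (x - y) - 2 * f x‖ₑ ≤ ENNReal.ofReal (‖y‖ ^ 2) *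
      ((∫⁻ x, ‖pdm 2 0 f x‖ₑ) + 2 * (∫⁻ x, ‖pdm 1 1 f x‖ₑ) + ∫⁻ x, ‖pdm 0 2 f x‖ₑ) := by
  refine (diff2_bound f y).trans ?_
  have hy : ∀ i, |y i| ≤ ‖y‖ := fun i => by
    simpa using PiLp.norm_apply_le y i
  have m20 : Measurable (fun x => ‖pdm 2 0 f x‖ₑ) := (cont_pd2 0 0 f).enorm.measurable
  have m11 : Measurable (fun x => ‖pdm 1 1 f x‖ₑ) := (cont_pd2 0 1 f).enorm.measurable
  have m02 : Measurable (fun x => ‖pdm 0 2 f x‖ₑ) := (cont_pd2 1 1 f).enorm.measurable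
  rw [← lintegral_const_mul _ m11, ← lintegral_add_left m20, ← lintegral_add_left (by fun_prop),
    ← lintegral_const_mul _ (by fun_prop)]
  refine lintegral_mono fun x => ?_
  have hr : ‖(∂_{y} (∂_{y} f) : 𝓢(E2, ℂ)) x‖ ≤
      ‖y‖ ^ 2 * (‖pdm 2 0 f x‖ + 2 * ‖pdm 1 1 f x‖ + ‖pdm 0 2 f x‖) := by
    rw [lineDeriv_decomp2]
    refine (norm_add₃_le).trans ?_
    simp only [norm_mul, norm_pow, Complex.norm_real, Real.norm_eq_abs]
    have a0 : |y 0| ^ 2 ≤ ‖y‖ ^ 2 := pow_le_pow_left₀ (abs_nonneg _) (hy 0) 2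
    have a1 : |y 1| ^ 2 ≤ ‖y‖ ^ 2 := pow_le_pow_left₀ (abs_nonneg _) (hy 1) 2
    have a2 : |y 0| * |y 1| ≤ ‖y‖ ^ 2 := by
      rw [pow_two]; exact mul_le_mul (hy 0) (hy 1) (abs_nonneg _) (norm_nonneg _)
    have h2 : ‖(2:ℂ)‖ = 2 := by simp
    rw [h2, mul_add, mul_add]
    gcongr
  simp only [← ofReal_norm]
  have h22 : ∀ a : ℝ≥0∞, 2 * a = ENNReal.ofReal 2 * a := fun a => by simp
  rw [h22, ← ENNReal.ofReal_mul (by norm_num), ← ENNReal.ofReal_add (by positivity) (by positivity),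
    ← ENNReal.ofReal_add (by positivity) (by positivity), ← ENNReal.ofReal_mul (by positivity)]
  exact ENNReal.ofReal_le_ofReal hr

lemma diff0_bound (f : 𝓢(E2, ℂ)) (y : E2) :
    ∫⁻ x, ‖f (x + y) + f (x - y) - 2 * f x‖ₑ ≤ 4 * ∫⁻ x, ‖f x‖ₑ := by
  have hc := f.continuous
  calc ∫⁻ x, ‖f (x + y) + f (x - y) - 2 * f x‖ₑ
      ≤ ∫⁻ x, ((‖f (x + y)‖ₑ + ‖f (x - y)‖ₑ) + 2 * ‖f x‖ₑ) := by
        refine lintegral_mono fun x => ?_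
        refine (enorm_sub_le).trans ?_
        refine add_le_add (enorm_add_le _ _) ?_
        rw [enorm_mul]
        simp [← ofReal_norm]
    _ = 4 * ∫⁻ x, ‖f x‖ₑ := by
        have m0 : Measurable (fun x => ‖f x‖ₑ) := hc.enorm.measurable
        have m1 : Measurable (fun x => ‖f (x + y)‖ₑ) := Continuous.measurable (by fun_prop)
        have m2 : Measurable (fun x => ‖f (x - y)‖ₑ) := Continuous.measurable (by fun_prop)
        rw [lintegral_add_left (m1.fun_add m2), lintegral_add_left m1,
          lintegral_const_mul _ m0,
          lintegral_add_right_eq_self (fun x => ‖f x‖ₑ) y,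
          lintegral_sub_right_eq_self (fun x => ‖f x‖ₑ) y]
        ring

noncomputable def SS (f : 𝓢(E2, ℂ)) : ℝ≥0∞ :=
  ∑ γ ∈ Finset.filter (fun γ => γ.1 + γ.2 ≤ 2) (Finset.range 3 ×ˢ Finset.range 3),
            eLpNorm (pdm γ.1 γ.2 ⇑f) 1 volume

lemma le_SS (f : 𝓢(E2, ℂ)) (a b : ℕ) (h : a + b ≤ 2) : ∫⁻ x, ‖pdm a b f x‖ₑ ≤ SS f := by
  rw [← eLpNorm_one_eq_lintegral_enorm]
  exact Finset.single_le_sum (f := fun γ : ℕ × ℕ => eLpNorm (pdm γ.1 γ.2 ⇑f) 1 volume)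
    (fun _ _ => zero_le) (a := (a, b)) (by simp; omega)

lemma N_bound (f : 𝓢(E2, ℂ)) (y : E2) :
    ∫⁻ x, ‖f (x + y) + f (x - y) - 2 * f x‖ₑ ≤ ENNReal.ofReal (min 1 (‖y‖ ^ 2)) * (4 * SS f) := by
  rcases le_total 1 (‖y‖ ^ 2) with h | h
  · rw [min_eq_left h, ENNReal.ofReal_one, one_mul]
    refine (diff0_bound f y).trans ?_
    gcongr
    exact le_SS f 0 0 (by norm_num)
  · rw [min_eq_right h]
    refine (diff2_bound' f y).trans ?_
    gcongr
    calc _ ≤ SS f + 2 * SS f + SS f := by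
          gcongr
          · exact le_SS f 2 0 (by norm_num)
          · exact le_SS f 1 1 (by norm_num)
          · exact le_SS f 0 2 (by norm_num)
      _ = 4 * SS f := by ring

noncomputable def ee (η x : E2) : ℂ := Complex.exp ((2 * π * ⟪η, x⟫_ℝ : ℝ) * Complex.I)

lemma norm_ee (η x : E2) : ‖ee η x‖ = 1 := Complex.norm_exp_ofReal_mul_I _

lemma cont_ee (x : E2) : Continuous (fun η => ee η x) := by unfold ee; fun_prop

lemma cont_F (f : 𝓢(E2, ℂ)) : Continuous (𝓕 (f : E2 → ℂ)) := by
  rw [← SchwartzMap.fourier_coe]; exact SchwartzMap.continuous _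

lemma int_F (f : 𝓢(E2, ℂ)) (k : ℕ) : Integrable (fun η => ‖η‖ ^ k * ‖𝓕 (f : E2 → ℂ) η‖) := by
  simp only [← SchwartzMap.fourier_coe]; exact SchwartzMap.integrable_pow_mul _ _ k

lemma int_ee (f : 𝓢(E2, ℂ)) (x : E2) : Integrable (fun η => ee η x * 𝓕 (f : E2 → ℂ) η) := by
  refine (int_F f 0).mono' ((cont_ee x).mul (cont_F f)).aestronglyMeasurable ?_
  filter_upwards with η
  simp [norm_ee]

lemma inner_formula (f : 𝓢(E2, ℂ)) (x y : E2) :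
    ∫ η : E2, ee η x * 𝓕 (f : E2 → ℂ) η * ((1 - Real.cos ⟪y, (2 * π) • η⟫_ℝ : ℝ) : ℂ) =
      -(1/2) * (f (x + y) + f (x - y) - 2 * f x) := by
  rw [← inv_formula f x, ← inv_formula f (x + y), ← inv_formula f (x - y)]
  change _ = -(1/2) * ((∫ η, ee η (x + y) * 𝓕 (f : E2 → ℂ) η) + (∫ η, ee η (x - y) * 𝓕 (f : E2 → ℂ) η) -
    2 * ∫ η, ee η x * 𝓕 (f : E2 → ℂ) η)
  rw [← integral_const_mul, ← integral_add (int_ee f _) (int_ee f _),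
    ← integral_sub (Integrable.fun_add (int_ee f _) (int_ee f _)) ((int_ee f _).const_mul _), ← integral_const_mul]
  congr 1
  ext η
  have h1 : ee η (x + y) = ee η x * Complex.exp ((2 * π * ⟪η, y⟫_ℝ : ℝ) * Complex.I) := by
    unfold ee; rw [← Complex.exp_add, inner_add_right]; congr 1; push_cast; ring
  have h2 : ee η (x - y) = ee η x * Complex.exp (-(2 * π * ⟪η, y⟫_ℝ : ℝ) * Complex.I) := by
    unfold ee; rw [← Complex.exp_add, inner_sub_right]; congr 1; push_cast; ring
  rw [h1, h2, real_inner_smul_right, real_inner_comm η y]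
  have h3 := Complex.two_cos ((2 * π * ⟪η, y⟫_ℝ : ℝ) : ℂ)
  rw [Complex.ofReal_sub, Complex.ofReal_cos, Complex.ofReal_one]
  linear_combination (-1/2 : ℂ) * (ee η x * 𝓕 (f : E2 → ℂ) η) * h3

lemma int_prod (s : ℝ) (hs0 : 0 < s) (hs2 : s < 2) (f : 𝓢(E2, ℂ)) (x : E2) :
    Integrable (Function.uncurry fun η y : E2 => ee η x * 𝓕 (f : E2 → ℂ) η *
      (((1 - Real.cos ⟪y, (2 * π) • η⟫_ℝ) * ‖y‖ ^ (-2 - s) : ℝ) : ℂ)) (volume.prod volume) := by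
  have hnn : ∀ η y : E2, 0 ≤ (1 - Real.cos ⟪y, (2 * π) • η⟫_ℝ) * ‖y‖ ^ (-2 - s) := fun η y =>
    mul_nonneg (by linarith [Real.cos_le_one ⟪y, (2 * π) • η⟫_ℝ]) (by positivity)
  have hm : Measurable (Function.uncurry fun η y : E2 => ee η x * 𝓕 (f : E2 → ℂ) η *
      (((1 - Real.cos ⟪y, (2 * π) • η⟫_ℝ) * ‖y‖ ^ (-2 - s) : ℝ) : ℂ)) := by
    have m1 : Measurable (fun p : E2 × E2 => ee p.1 x * 𝓕 (f : E2 → ℂ) p.1) :=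
      ((cont_ee x).mul (cont_F f)).measurable.comp measurable_fst
    have m2 : Measurable (fun p : E2 × E2 => 1 - Real.cos ⟪p.2, (2 * π) • p.1⟫_ℝ) :=
      Continuous.measurable (by fun_prop)
    have m3 : Measurable (fun p : E2 × E2 => ‖p.2‖ ^ (-2 - s)) := (meas_weight s).comp measurable_snd
    exact m1.mul (Complex.measurable_ofReal.comp (m2.mul m3))
  rw [integrable_prod_iff hm.aestronglyMeasurable]
  constructor
  · filter_upwards with η
    exact ((integrable_K s hs0 hs2 ((2 * π) • η)).ofReal (𝕜 := ℂ)).const_mul (ee η x * 𝓕 (f : E2 → ℂ) η)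
  · have he : ∀ η : E2, ∫ y : E2, ‖Function.uncurry (fun η y : E2 => ee η x * 𝓕 (f : E2 → ℂ) η *
      (((1 - Real.cos ⟪y, (2 * π) • η⟫_ℝ) * ‖y‖ ^ (-2 - s) : ℝ) : ℂ)) (η, y)‖ =
        ((2 * π) ^ s * Kf s e0) * (‖η‖ ^ s * ‖𝓕 (f : E2 → ℂ) η‖) := by
      intro η
      have : ∀ y : E2, ‖Function.uncurry (fun η y : E2 => ee η x * 𝓕 (f : E2 → ℂ) η *
        (((1 - Real.cos ⟪y, (2 * π) • η⟫_ℝ) * ‖y‖ ^ (-2 - s) : ℝ) : ℂ)) (η, y)‖ = ‖𝓕 (f : E2 → ℂ) η‖ *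
          ((1 - Real.cos ⟪y, (2 * π) • η⟫_ℝ) * ‖y‖ ^ (-2 - s)) := by
        intro y
        simp only [Function.uncurry_apply_pair]
        rw [norm_mul, norm_mul, norm_ee, Complex.norm_real, Real.norm_of_nonneg (hnn η y), one_mul]
      simp only [this]
      rw [integral_const_mul]
      change _ * Kf s _ = _
      rw [Kf_smul _ _ (by positivity), Kf_eq s hs0 η]
      ring
    simp only [he]
    apply Integrable.const_mul
    refine ((int_F f 0).add (int_F f 2)).mono' ?_ ?_
    · exact ((measurable_norm.pow_const s).mul (cont_F f).norm.measurable).aestronglyMeasurable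
    · filter_upwards with η
      rw [Real.norm_of_nonneg (by positivity), Pi.add_apply, ← add_mul]
      gcongr
      rcases le_total ‖η‖ 1 with h | h
      · have := Real.rpow_le_one (norm_nonneg η) h hs0.le
        nlinarith [sq_nonneg ‖η‖]
      · have := Real.rpow_le_rpow_of_exponent_le h hs2.le
        rw [Real.rpow_two] at this
        linarith [pow_zero ‖η‖]

lemma fmult_repr (s : ℝ) (hs0 : 0 < s) (hs2 : s < 2) (f : 𝓢(E2, ℂ)) (x : E2) :
    fmult (fun ξ => ((‖ξ‖ ^ s : ℝ) : ℂ)) f x = (((Kf s e0)⁻¹ : ℝ) : ℂ) *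
      ∫ y : E2, (-(1/2) * (f (x + y) + f (x - y) - 2 * f x)) * ((‖y‖ ^ (-2 - s) : ℝ) : ℂ) := by
  have hK := Kf_pos s hs0 hs2
  have h1 : ∀ y : E2, (-(1/2) * (f (x + y) + f (x - y) - 2 * f x)) * ((‖y‖ ^ (-2 - s) : ℝ) : ℂ) =
      ∫ η : E2, ee η x * 𝓕 (f : E2 → ℂ) η *
        (((1 - Real.cos ⟪y, (2 * π) • η⟫_ℝ) * ‖y‖ ^ (-2 - s) : ℝ) : ℂ) := by
    intro y
    rw [← inner_formula, ← integral_mul_const]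
    congr 1; ext η; push_cast; ring
  simp only [h1]
  rw [← integral_integral_swap (int_prod s hs0 hs2 f x), fmult_eq_s9, ← integral_const_mul]
  congr 1
  ext η
  rw [integral_const_mul, integral_complex_ofReal]
  change ee η x * _ = _ * (_ * ((Kf s _ : ℝ) : ℂ))
  rw [Kf_eq s hs0 ((2 * π) • η)]
  have : ((Kf s e0 : ℝ) : ℂ) ≠ 0 := by exact_mod_cast hK.ne'
  push_cast
  field_simp

lemma case_mid (s : ℝ) (hs0 : 0 < s) (hs2 : s < 2) (f : 𝓢(E2, ℂ)) :
    eLpNorm ((fmult (fun ξ => ((‖ξ‖ ^ s : ℝ) : ℂ)) ⇑f)) 1 volume ≤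
      ENNReal.ofReal ((Kf s e0)⁻¹ * ((∫ y : E2, min 1 (‖y‖ ^ 2) * ‖y‖ ^ (-2 - s)) * 4)) * SS f := by
  have hK := Kf_pos s hs0 hs2
  have hc := f.continuous
  have hw := meas_weight s
  rw [eLpNorm_one_eq_lintegral_enorm]
  have hb : ∀ x, ‖fmult (fun ξ => ((‖ξ‖ ^ s : ℝ) : ℂ)) f x‖ₑ ≤ ENNReal.ofReal (Kf s e0)⁻¹ *
      ∫⁻ y : E2, ‖f (x + y) + f (x - y) - 2 * f x‖ₑ * ENNReal.ofReal (‖y‖ ^ (-2 - s)) := by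
    intro x
    rw [fmult_repr s hs0 hs2, enorm_mul]
    gcongr
    · rw [← ofReal_norm, Complex.norm_real, Real.norm_of_nonneg (by positivity)]
    · refine (enorm_integral_le_lintegral_enorm _).trans (lintegral_mono fun y => ?_)
      rw [← ofReal_norm, ← ofReal_norm, ← ENNReal.ofReal_mul (norm_nonneg _)]
      apply ENNReal.ofReal_le_ofReal
      rw [norm_mul, norm_mul, Complex.norm_real, Real.norm_of_nonneg (by positivity : 0 ≤ ‖y‖ ^ (-2 - s))]
      gcongr
      have : ‖(-(1/2) : ℂ)‖ = 1/2 := by simp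
      rw [this]
      linarith [norm_nonneg (f (x + y) + f (x - y) - 2 * f x)]
  have hm : Measurable (Function.uncurry fun x y : E2 =>
      ‖f (x + y) + f (x - y) - 2 * f x‖ₑ * ENNReal.ofReal (‖y‖ ^ (-2 - s))) := by
    have m1 : Measurable (fun p : E2 × E2 => ‖f (p.1 + p.2) + f (p.1 - p.2) - 2 * f p.1‖ₑ) :=
      Continuous.measurable (by fun_prop)
    exact m1.mul (ENNReal.measurable_ofReal.comp (hw.comp measurable_snd))
  calc _ ≤ ∫⁻ x : E2, ENNReal.ofReal (Kf s e0)⁻¹ *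
      ∫⁻ y : E2, ‖f (x + y) + f (x - y) - 2 * f x‖ₑ * ENNReal.ofReal (‖y‖ ^ (-2 - s)) := lintegral_mono hb
    _ = ENNReal.ofReal (Kf s e0)⁻¹ * ∫⁻ y : E2, ∫⁻ x : E2,
        ‖f (x + y) + f (x - y) - 2 * f x‖ₑ * ENNReal.ofReal (‖y‖ ^ (-2 - s)) := by
        rw [lintegral_const_mul' _ _ ENNReal.ofReal_ne_top, lintegral_lintegral_swap hm.aemeasurable]
    _ ≤ ENNReal.ofReal (Kf s e0)⁻¹ * ∫⁻ y : E2,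
        ENNReal.ofReal (min 1 (‖y‖ ^ 2) * ‖y‖ ^ (-2 - s)) * (4 * SS f) := by
        gcongr with y
        rw [lintegral_mul_const' _ _ ENNReal.ofReal_ne_top, ENNReal.ofReal_mul (by positivity)]
        calc _ ≤ (ENNReal.ofReal (min 1 (‖y‖ ^ 2)) * (4 * SS f)) * ENNReal.ofReal (‖y‖ ^ (-2 - s)) := by
              gcongr; exact N_bound f y
          _ = _ := by ring
    _ = _ := by
        rw [lintegral_mul_const _ (by fun_prop), ← ofReal_integral_eq_lintegral_ofReal (integrable_weight s hs0 hs2)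
          (Filter.Eventually.of_forall fun y => by positivity), ENNReal.ofReal_mul (by positivity),
          ENNReal.ofReal_mul (integral_nonneg fun y => by positivity)]
        rw [show ENNReal.ofReal 4 = 4 by simp]
        ring

/-- `‖|D|^s f‖_{L¹(ℝ²)} ≤ C ‖f‖_{W^{2,1}(ℝ²)}` for `s ∈ [0,2]` (Lemma B.5). -/
theorem stmt9 (s : ℝ) (hs0 : 0 ≤ s) (hs2 : s ≤ 2) :
    ∃ C : ℝ, 0 < C ∧ ∀ f : SchwartzMap (EuclideanSpace ℝ (Fin 2)) ℂ,
      eLpNorm ((fmult (fun ξ => ((‖ξ‖ ^ s : ℝ) : ℂ)) ⇑f)) 1 volume ≤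
        ENNReal.ofReal C *
          ∑ γ ∈ Finset.filter (fun γ => γ.1 + γ.2 ≤ 2) (Finset.range 3 ×ˢ Finset.range 3),
            eLpNorm (pdm γ.1 γ.2 ⇑f) 1 volume := by
  change ∃ C : ℝ, 0 < C ∧ ∀ f : 𝓢(E2, ℂ), _ ≤ ENNReal.ofReal C * SS f
  rcases hs0.eq_or_lt with rfl | h0
  · refine ⟨1, one_pos, fun f => ?_⟩
    have h : fmult (fun ξ => ((‖ξ‖ ^ (0:ℝ) : ℝ) : ℂ)) ⇑f = f := funext (case_zero f)
    rw [h, ENNReal.ofReal_one, one_mul, eLpNorm_one_eq_lintegral_enorm]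
    exact le_SS f 0 0 (by norm_num)
  rcases hs2.eq_or_lt with rfl | h2
  · refine ⟨2, two_pos, fun f => ?_⟩
    rw [eLpNorm_one_eq_lintegral_enorm]
    calc _ ≤ ∫⁻ x, (‖pdm 2 0 f x‖ₑ + ‖pdm 0 2 f x‖ₑ) := by
          refine lintegral_mono fun x => ?_
          rw [case_two, enorm_neg]
          exact enorm_add_le _ _
      _ ≤ SS f + SS f := by
          rw [lintegral_add_left (show Measurable (fun x => ‖pdm 2 0 f x‖ₑ) from (cont_pd2 0 0 f).enorm.measurable)]
          exact add_le_add (le_SS f 2 0 (by norm_num)) (le_SS f 0 2 (by norm_num))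
      _ = _ := by rw [← two_mul]; simp
  · refine ⟨max 1 ((Kf s e0)⁻¹ * ((∫ y : E2, min 1 (‖y‖ ^ 2) * ‖y‖ ^ (-2 - s)) * 4)),
      lt_max_of_lt_left one_pos, fun f => (case_mid s h0 h2 f).trans ?_⟩
    gcongr
    exact le_max_right _ _
end
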